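/- arXiv:2309.00130 — 4 statements merged into one kernel-verified Lean document; each statement's English description precedes it below -/
import Mathlib

section
/- Let n ≥ 1 be an integer, let 0 < m < n, σ > 0 and κ > n − σ be real numbers. Let μ be a compactly supported Borel probability measure on ℝ^n for which there are constants C₁, c > 0 with |μ̂(ξ)| ≤ C₁|ξ|^{−σ} for all ξ ≠ 0 and μ(B(x,r)) ≥ c r^m for every x ∈ supp μ and every 0 < r ≤ 1. Let λ be a compactly supported Borel probability measure on ℝ^n for which there is C₂ > 0 with ∫_{|ξ|≤R} |λ̂(ξ)| dξ ≤ C₂ R^{n−κ} for all R ≥ 1. Then there exists C > 0 such that λ((supp μ)^δ) ≤ C δ^{n−m} for all δ ∈ (0,1). -/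
open MeasureTheory Metric Filter Set
open scoped ENNReal NNReal Real Topology

noncomputable section

/-- The Fourier transform of a measure on ℝⁿ: `μ̂(ξ) = ∫ e^{-2πi⟨x,ξ⟩} dμ(x)`. -/
def mft {n : ℕ} (μ : Measure (EuclideanSpace ℝ (Fin n))) (ξ : EuclideanSpace ℝ (Fin n)) : ℂ :=
  ∫ x, Complex.exp ((((-(2 * Real.pi * (inner ℝ x ξ : ℝ))) : ℝ) : ℂ) * Complex.I) ∂μ

/-- The support of a measure on a metric space: points all of whose neighbourhoods have
positive measure. -/
def msupp {X : Type*} [PseudoMetricSpace X] [MeasurableSpace X] (μ : Measure X) : Set X :=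
  {x | ∀ r : ℝ, 0 < r → 0 < μ (Metric.ball x r)}


section helpers

variable {n : ℕ}

local notation "EE" => EuclideanSpace ℝ (Fin n)

/-- The character. -/
def chr (x ξ : EE) : ℂ :=
  Complex.exp ((((-(2 * Real.pi * (inner ℝ x ξ : ℝ))) : ℝ) : ℂ) * Complex.I)

lemma norm_chr (x ξ : EE) : ‖chr x ξ‖ = 1 := by
  unfold chr
  exact Complex.norm_exp_ofReal_mul_I _

lemma continuous_chr : Continuous (fun p : EE × EE => chr p.1 p.2) := by
  unfold chr
  fun_prop

lemma continuous_chr' {X : Type*} [TopologicalSpace X] {f g : X → EE} (hf : Continuous f)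
    (hg : Continuous g) : Continuous (fun a => chr (f a) (g a)) := by
  unfold chr
  fun_prop

lemma continuous_mft (μ : Measure EE) [IsProbabilityMeasure μ] : Continuous (mft μ) := by
  have : mft μ = fun ξ => ∫ x, chr x ξ ∂μ := rfl
  rw [this]
  refine continuous_of_dominated (bound := fun _ => 1) ?_ ?_ (integrable_const _) ?_
  · intro ξ
    exact (continuous_chr.comp (by fun_prop : Continuous fun x : EE => (x, ξ))).aestronglyMeasurable
  · intro ξ
    exact Eventually.of_forall fun x => (norm_chr x ξ).le
  · refine Eventually.of_forall fun x => ?_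
    exact continuous_chr.comp (by fun_prop : Continuous fun ξ : EE => (x, ξ))

lemma norm_mft_le (μ : Measure EE) [IsProbabilityMeasure μ] (ξ : EE) : ‖mft μ ξ‖ ≤ 1 := by
  have : mft μ ξ = ∫ x, chr x ξ ∂μ := rfl
  rw [this]
  refine (norm_integral_le_integral_norm _).trans ?_
  simp [norm_chr]

lemma gauss_id (x y : EE) (δ : ℝ) (hδ : 0 < δ) :
    ((Real.exp (-π * ‖x - y‖ ^ 2 / δ ^ 2) : ℝ) : ℂ) =
      (δ : ℂ) ^ n * ∫ ξ : EE, ((Real.exp (-(π * δ ^ 2) * ‖ξ‖ ^ 2) : ℝ) : ℂ) *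
        (chr x ξ * (starRingEnd ℂ) (chr y ξ)) := by
  have hb : 0 < ((π * δ ^ 2 : ℝ) : ℂ).re := by
    rw [Complex.ofReal_re]; positivity
  have h := GaussianFourier.integral_cexp_neg_mul_sq_norm_add (V := EE) hb
    (-2 * π * Complex.I) (x - y)
  have h2 : ∀ ξ : EE, ((Real.exp (-(π * δ ^ 2) * ‖ξ‖ ^ 2) : ℝ) : ℂ) *
        (chr x ξ * (starRingEnd ℂ) (chr y ξ)) =
      Complex.exp (-((π * δ ^ 2 : ℝ) : ℂ) * ‖ξ‖ ^ 2 +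
        (-2 * π * Complex.I) * (inner ℝ (x - y) ξ : ℝ)) := by
    intro ξ
    unfold chr
    rw [← Complex.exp_conj, Complex.ofReal_exp, ← Complex.exp_add, ← Complex.exp_add]
    congr 1
    rw [inner_sub_left]
    simp only [map_mul, Complex.conj_ofReal, Complex.conj_I]
    push_cast
    ring
  simp_rw [h2]
  rw [h]
  have hd : (δ : ℂ) ≠ 0 := by exact_mod_cast hδ.ne'
  have hpi : (π : ℂ) ≠ 0 := by exact_mod_cast Real.pi_ne_zero
  have e1 : (π / ((π * δ ^ 2 : ℝ) : ℂ)) ^ ((Module.finrank ℝ EE : ℂ) / 2) = ((δ : ℂ) ^ n)⁻¹ := by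
    have : (π / ((π * δ ^ 2 : ℝ) : ℂ)) = (((δ ^ 2)⁻¹ : ℝ) : ℂ) := by
      push_cast; field_simp
    rw [this, finrank_euclideanSpace_fin]
    have h3 : ((n : ℂ) / 2) = (((n : ℝ) / 2 : ℝ) : ℂ) := by push_cast; rfl
    rw [h3, ← Complex.ofReal_cpow (by positivity)]
    rw [Real.inv_rpow (by positivity), ← Real.rpow_natCast δ 2, ← Real.rpow_mul hδ.le]
    have : ((2 : ℕ) : ℝ) * ((n : ℝ) / 2) = n := by push_cast; ring
    rw [this, Real.rpow_natCast]
    push_cast; rfl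
  rw [e1, mul_inv_cancel_left₀ (pow_ne_zero _ hd), Complex.ofReal_exp]
  congr 1
  push_cast
  field_simp
  ring_nf
  simp

lemma integrable_gauss (δ : ℝ) (hδ : 0 < δ) :
    Integrable (fun ξ : EE => Real.exp (-(π * δ ^ 2) * ‖ξ‖ ^ 2)) := by
  have hb : 0 < ((π * δ ^ 2 : ℝ) : ℂ).re := by
    rw [Complex.ofReal_re]; positivity
  have h := (GaussianFourier.integrable_cexp_neg_mul_sq_norm_add (V := EE) hb 0 0).norm
  refine h.congr (Eventually.of_forall fun ξ => ?_)
  simp only [Complex.norm_exp]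
  congr 1
  norm_cast
  simp

lemma inner_prod (μ lam : Measure EE) [IsProbabilityMeasure μ] [IsProbabilityMeasure lam]
    (ξ : EE) : ∫ p : EE × EE, chr p.1 ξ * (starRingEnd ℂ) (chr p.2 ξ) ∂(μ.prod lam) =
      mft μ ξ * (starRingEnd ℂ) (mft lam ξ) := by
  have h1 : mft μ ξ = ∫ x, chr x ξ ∂μ := rfl
  have h2 : (starRingEnd ℂ) (mft lam ξ) = ∫ y, (starRingEnd ℂ) (chr y ξ) ∂lam :=
    (integral_conj (f := fun y => chr y ξ)).symm
  rw [h1, h2]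
  exact integral_prod_mul (fun x => chr x ξ) (fun y => (starRingEnd ℂ) (chr y ξ))

set_option maxHeartbeats 1000000 in
/-- Parseval-type identity. -/
lemma parseval (μ lam : Measure EE) [IsProbabilityMeasure μ] [IsProbabilityMeasure lam]
    (δ : ℝ) (hδ : 0 < δ) :
    ((∫ p : EE × EE, Real.exp (-π * ‖p.1 - p.2‖ ^ 2 / δ ^ 2) ∂(μ.prod lam) : ℝ) : ℂ) =
      (δ : ℂ) ^ n * ∫ ξ : EE, ((Real.exp (-(π * δ ^ 2) * ‖ξ‖ ^ 2) : ℝ) : ℂ) *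
        (mft μ ξ * (starRingEnd ℂ) (mft lam ξ)) := by
  rw [← integral_complex_ofReal]
  simp_rw [fun p : EE × EE => gauss_id p.1 p.2 δ hδ]
  rw [integral_const_mul]
  congr 1
  rw [integral_integral_swap]
  · congr 1
    ext ξ
    rw [integral_const_mul]
    congr 1
    exact inner_prod μ lam ξ
  · have hg := (integrable_gauss (n := n) δ hδ).comp_snd (μ.prod lam)
    refine hg.mono' ?_ (Eventually.of_forall fun q => ?_)
    · refine Continuous.aestronglyMeasurable ?_
      have c1 : Continuous fun q : (EE × EE) × EE => chr q.1.1 q.2 :=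
        continuous_chr' (continuous_fst.comp continuous_fst) continuous_snd
      have c2 : Continuous fun q : (EE × EE) × EE => chr q.1.2 q.2 :=
        continuous_chr' (continuous_snd.comp continuous_fst) continuous_snd
      have c3 := Complex.continuous_conj.comp c2
      simp only [Function.uncurry_def]
      refine Continuous.mul (by fun_prop) (c1.mul c3)
    · simp only [Function.uncurry_def, norm_mul, norm_chr, RCLike.norm_conj, mul_one]
      rw [Complex.norm_real, Real.norm_of_nonneg (Real.exp_pos _).le]

lemma integrable_main (σ : ℝ) (hσ : 0 < σ) (κ : ℝ) (hκ : (n : ℝ) - σ < κ)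
    (μ lam : Measure EE) [IsProbabilityMeasure μ] [IsProbabilityMeasure lam]
    (C₁ : ℝ) (hC₁ : 0 < C₁)
    (hdecay : ∀ ξ : EE, ξ ≠ 0 → ‖mft μ ξ‖ ≤ C₁ * ‖ξ‖ ^ (-σ))
    (C₂ : ℝ) (hC₂ : 0 < C₂)
    (hlam : ∀ R : ℝ, 1 ≤ R →
      ∫ ξ in Metric.closedBall (0 : EE) R, ‖mft lam ξ‖ ≤ C₂ * R ^ ((n : ℝ) - κ)) :
    Integrable (fun ξ : EE => ‖mft μ ξ‖ * ‖mft lam ξ‖) := by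
  have cμ := continuous_mft μ
  have cl := continuous_mft lam
  have hl : ∀ R : ℝ, 1 ≤ R → ∫⁻ ξ in Metric.closedBall (0 : EE) R, ENNReal.ofReal ‖mft lam ξ‖ ≤
      ENNReal.ofReal (C₂ * R ^ ((n : ℝ) - κ)) := by
    intro R hR
    rw [← ofReal_integral_eq_lintegral_ofReal]
    · exact ENNReal.ofReal_le_ofReal (hlam R hR)
    · exact cl.norm.continuousOn.integrableOn_compact (isCompact_closedBall _ _)
    · exact Eventually.of_forall fun _ => norm_nonneg _
  refine ⟨(cμ.norm.mul cl.norm).aestronglyMeasurable, ?_⟩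
  rw [hasFiniteIntegral_iff_ofReal (Eventually.of_forall fun ξ => by positivity)]
  let A : ℕ → Set EE := fun k => {ξ | (2 : ℝ) ^ k ≤ ‖ξ‖ ∧ ‖ξ‖ ≤ (2 : ℝ) ^ (k + 1)}
  have hcover : (univ : Set EE) ⊆ Metric.closedBall 0 1 ∪ ⋃ k, A k := by
    intro ξ _
    by_cases h : ‖ξ‖ ≤ 1
    · left; simpa using h
    · right
      obtain ⟨k, hk1, hk2⟩ := exists_nat_pow_near (not_le.mp h).le (one_lt_two : (1 : ℝ) < 2)
      exact mem_iUnion.mpr ⟨k, hk1, hk2.le⟩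
  have hball : ∫⁻ ξ in Metric.closedBall (0 : EE) 1, ENNReal.ofReal (‖mft μ ξ‖ * ‖mft lam ξ‖) < ⊤ := by
    refine lt_of_le_of_lt (lintegral_mono fun ξ => ?_) ((hl 1 le_rfl).trans_lt ENNReal.ofReal_lt_top)
    refine ENNReal.ofReal_le_ofReal ?_
    exact mul_le_of_le_one_left (norm_nonneg _) (norm_mft_le μ ξ)
  set D : ℝ := C₁ * C₂ * (2 : ℝ) ^ ((n : ℝ) - κ) with hD
  set q : ℝ := (2 : ℝ) ^ ((n : ℝ) - κ - σ) with hq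
  have hann : ∀ k, ∫⁻ ξ in A k, ENNReal.ofReal (‖mft μ ξ‖ * ‖mft lam ξ‖) ≤
      ENNReal.ofReal (D * q ^ k) := by
    intro k
    have hmeas : MeasurableSet (A k) := by
      apply IsClosed.measurableSet
      exact (isClosed_le continuous_const continuous_norm).inter
        (isClosed_le continuous_norm continuous_const)
    have h2k : (0 : ℝ) < 2 ^ k := by positivity
    calc ∫⁻ ξ in A k, ENNReal.ofReal (‖mft μ ξ‖ * ‖mft lam ξ‖)
        ≤ ∫⁻ ξ in A k, ENNReal.ofReal (C₁ * ((2 : ℝ) ^ k) ^ (-σ)) * ENNReal.ofReal ‖mft lam ξ‖ := by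
          refine setLIntegral_mono' hmeas fun ξ hξ => ?_
          rw [← ENNReal.ofReal_mul (by positivity)]
          refine ENNReal.ofReal_le_ofReal ?_
          refine mul_le_mul_of_nonneg_right ?_ (norm_nonneg _)
          have hpos : 0 < ‖ξ‖ := h2k.trans_le hξ.1
          refine (hdecay ξ (norm_pos_iff.mp hpos)).trans ?_
          refine mul_le_mul_of_nonneg_left ?_ hC₁.le
          exact Real.rpow_le_rpow_of_nonpos h2k hξ.1 (by linarith)
      _ = ENNReal.ofReal (C₁ * ((2 : ℝ) ^ k) ^ (-σ)) * ∫⁻ ξ in A k, ENNReal.ofReal ‖mft lam ξ‖ := by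
          rw [lintegral_const_mul' _ _ ENNReal.ofReal_ne_top]
      _ ≤ ENNReal.ofReal (C₁ * ((2 : ℝ) ^ k) ^ (-σ)) *
            ENNReal.ofReal (C₂ * ((2 : ℝ) ^ (k + 1)) ^ ((n : ℝ) - κ)) := by
          gcongr
          refine le_trans (lintegral_mono_set ?_) (hl _ (one_le_pow₀ one_le_two))
          intro ξ hξ
          simpa using hξ.2
      _ = ENNReal.ofReal (D * q ^ k) := by
          rw [← ENNReal.ofReal_mul (by positivity)]
          congr 1
          rw [hD, hq, ← Real.rpow_natCast, ← Real.rpow_natCast, ← Real.rpow_natCast,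
            ← Real.rpow_mul zero_le_two, ← Real.rpow_mul zero_le_two, ← Real.rpow_mul zero_le_two]
          have : (2 : ℝ) ^ ((k : ℝ) * -σ) * (2 : ℝ) ^ (((k + 1 : ℕ) : ℝ) * ((n : ℝ) - κ)) =
              (2 : ℝ) ^ ((n : ℝ) - κ) * (2 : ℝ) ^ (((n : ℝ) - κ - σ) * (k : ℝ)) := by
            rw [← Real.rpow_add two_pos, ← Real.rpow_add two_pos]
            congr 1
            push_cast; ring
          linear_combination C₁ * C₂ * this
  have hq0 : 0 ≤ q := by positivity
  have hq1 : q < 1 := Real.rpow_lt_one_of_one_lt_of_neg one_lt_two (by linarith)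
  have hsum : ∑' k, ENNReal.ofReal (D * q ^ k) < ⊤ :=
    lt_top_iff_ne_top.mpr ((summable_geometric_of_lt_one hq0 hq1).mul_left D).tsum_ofReal_ne_top
  calc ∫⁻ ξ, ENNReal.ofReal (‖mft μ ξ‖ * ‖mft lam ξ‖)
      = ∫⁻ ξ in univ, ENNReal.ofReal (‖mft μ ξ‖ * ‖mft lam ξ‖) := by rw [setLIntegral_univ]
    _ ≤ ∫⁻ ξ in Metric.closedBall (0 : EE) 1 ∪ ⋃ k, A k,
          ENNReal.ofReal (‖mft μ ξ‖ * ‖mft lam ξ‖) := lintegral_mono_set hcover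
    _ ≤ _ := lintegral_union_le _ _ _
    _ ≤ (∫⁻ ξ in Metric.closedBall (0 : EE) 1, ENNReal.ofReal (‖mft μ ξ‖ * ‖mft lam ξ‖)) +
          ∑' k, ENNReal.ofReal (D * q ^ k) := by
        gcongr
        exact (lintegral_iUnion_le _ _).trans (ENNReal.tsum_le_tsum hann)
    _ < ⊤ := ENNReal.add_lt_top.mpr ⟨hball, hsum⟩

end helpers

/-- if `μ` is a compactly supported probability measure on ℝⁿ with
`|μ̂(ξ)| ≤ C₁|ξ|^{-σ}` and `μ(B(x,r)) ≥ c rᵐ` on its support, and `λ` is a compactly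
supported probability measure with `∫_{|ξ|≤R} |λ̂(ξ)| dξ ≤ C₂ R^{n-κ}` where `κ > n - σ`,
then `λ((supp μ)^δ) ≤ C δ^{n-m}` for all `δ ∈ (0,1)`. -/
theorem statement0 (n : ℕ) (hn : 1 ≤ n) (m : ℝ) (hm0 : 0 < m) (hmn : m < n)
    (σ : ℝ) (hσ : 0 < σ) (κ : ℝ) (hκ : (n : ℝ) - σ < κ)
    (μ lam : Measure (EuclideanSpace ℝ (Fin n)))
    [IsProbabilityMeasure μ] [IsProbabilityMeasure lam]
    (hμcpt : ∃ K : Set (EuclideanSpace ℝ (Fin n)), IsCompact K ∧ μ Kᶜ = 0)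
    (hlamcpt : ∃ K : Set (EuclideanSpace ℝ (Fin n)), IsCompact K ∧ lam Kᶜ = 0)
    (C₁ c : ℝ) (hC₁ : 0 < C₁) (hc : 0 < c)
    (hdecay : ∀ ξ : EuclideanSpace ℝ (Fin n), ξ ≠ 0 → ‖mft μ ξ‖ ≤ C₁ * ‖ξ‖ ^ (-σ))
    (hreg : ∀ x ∈ msupp μ, ∀ r : ℝ, 0 < r → r ≤ 1 →
      ENNReal.ofReal (c * r ^ m) ≤ μ (Metric.closedBall x r))
    (C₂ : ℝ) (hC₂ : 0 < C₂)
    (hlam : ∀ R : ℝ, 1 ≤ R →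
      ∫ ξ in Metric.closedBall (0 : EuclideanSpace ℝ (Fin n)) R, ‖mft lam ξ‖ ≤
        C₂ * R ^ ((n : ℝ) - κ)) :
    ∃ C : ℝ, 0 < C ∧ ∀ δ : ℝ, 0 < δ → δ < 1 →
      lam (Metric.cthickening δ (msupp μ)) ≤ ENNReal.ofReal (C * δ ^ ((n : ℝ) - m)) := by
  have hint := integrable_main σ hσ κ hκ μ lam C₁ hC₁ hdecay C₂ hC₂ hlam
  set M : ℝ := ∫ ξ, ‖mft μ ξ‖ * ‖mft lam ξ‖ with hM
  have hM0 : 0 ≤ M := integral_nonneg fun ξ => by positivity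
  set a : ℝ := Real.exp (-9 * π) with ha
  have ha0 : 0 < a := Real.exp_pos _
  refine ⟨(M + 1) / (a * c), by positivity, fun δ hδ hδ1 => ?_⟩
  set g : EuclideanSpace ℝ (Fin n) × EuclideanSpace ℝ (Fin n) → ℝ :=
    fun p => Real.exp (-π * ‖p.1 - p.2‖ ^ 2 / δ ^ 2) with hg
  have gcont : Continuous g := by
    simp only [hg]
    fun_prop
  have g1 : ∀ p, g p ≤ 1 := by
    intro p
    simp only [hg]
    rw [Real.exp_le_one_iff]
    have : 0 ≤ π * ‖p.1 - p.2‖ ^ 2 / δ ^ 2 := by positivity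
    have e : -π * ‖p.1 - p.2‖ ^ 2 / δ ^ 2 = -(π * ‖p.1 - p.2‖ ^ 2 / δ ^ 2) := by ring
    linarith
  have g0 : ∀ p, 0 ≤ g p := fun p => (Real.exp_pos _).le
  have gint : Integrable g (μ.prod lam) := by
    refine Integrable.of_bound gcont.aestronglyMeasurable 1 (Eventually.of_forall fun p => ?_)
    rw [Real.norm_of_nonneg (g0 p)]
    exact g1 p
  have gint1 : ∀ y, Integrable (fun x => g (x, y)) μ := by
    intro y
    have : Continuous fun x => g (x, y) := gcont.comp (by fun_prop)
    refine Integrable.of_bound this.aestronglyMeasurable 1 (Eventually.of_forall fun p => ?_)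
    rw [Real.norm_of_nonneg (g0 _)]
    exact g1 _
  -- upper bound
  have hup : ∫ p, g p ∂(μ.prod lam) ≤ δ ^ n * M := by
    have h := parseval μ lam δ hδ
    have h' := congrArg norm h
    rw [Complex.norm_real, norm_mul, norm_pow, Complex.norm_real, Real.norm_of_nonneg hδ.le] at h'
    refine (Real.le_norm_self _).trans ?_
    rw [h']
    refine mul_le_mul_of_nonneg_left ?_ (by positivity)
    refine norm_integral_le_of_norm_le hint (Eventually.of_forall fun ξ => ?_)
    rw [norm_mul, norm_mul, RCLike.norm_conj, Complex.norm_real,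
      Real.norm_of_nonneg (Real.exp_pos _).le]
    refine mul_le_of_le_one_left (by positivity) ?_
    rw [Real.exp_le_one_iff]
    have : 0 ≤ (π * δ ^ 2) * ‖ξ‖ ^ 2 := by positivity
    linarith
  -- lower bound
  set F : EuclideanSpace ℝ (Fin n) → ℝ := fun y => ∫ x, g (x, y) ∂μ with hF
  have hlow : ∀ y ∈ Metric.cthickening δ (msupp μ), a * (c * δ ^ m) ≤ F y := by
    intro y hy
    have hy2 := Metric.cthickening_subset_thickening' (by positivity : 0 < 2 * δ)
      (by linarith : δ < 2 * δ) _ hy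
    obtain ⟨x, hx, hxy⟩ := Metric.mem_thickening_iff.mp hy2
    have hb := hreg x hx δ hδ hδ1.le
    have hbr : c * δ ^ m ≤ μ.real (Metric.closedBall x δ) :=
      (ENNReal.ofReal_le_iff_le_toReal (measure_ne_top _ _)).mp hb
    calc a * (c * δ ^ m) ≤ a * μ.real (Metric.closedBall x δ) := by gcongr
      _ = ∫ z in Metric.closedBall x δ, a ∂μ := by
          rw [setIntegral_const, smul_eq_mul, mul_comm]
      _ ≤ ∫ z in Metric.closedBall x δ, g (z, y) ∂μ := by
          refine setIntegral_mono_on (integrable_const _) (gint1 y).integrableOn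
            Metric.isClosed_closedBall.measurableSet fun z hz => ?_
          simp only [hg, ha]
          refine Real.exp_le_exp.mpr ?_
          have h3 : ‖z - y‖ ≤ 3 * δ := by
            rw [← dist_eq_norm]
            have h4 := dist_triangle z x y
            have h5 : dist z x ≤ δ := hz
            rw [dist_comm] at hxy
            linarith
          rw [le_div_iff₀ (by positivity)]
          have h6 : ‖z - y‖ ^ 2 ≤ (3 * δ) ^ 2 := by gcongr
          nlinarith [Real.pi_pos]
      _ ≤ F y := setIntegral_le_integral (gint1 y) (Eventually.of_forall fun z => g0 _)
  have hFint : Integrable F lam := gint.integral_prod_right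
  have hmk := mul_meas_ge_le_integral_of_nonneg (Eventually.of_forall fun y =>
    (integral_nonneg fun x => g0 (x, y) : 0 ≤ F y)) hFint (a * (c * δ ^ m))
  have hFI : ∫ y, F y ∂lam = ∫ p, g p ∂(μ.prod lam) := (integral_prod_symm g gint).symm
  rw [hFI] at hmk
  have hsub : lam.real (Metric.cthickening δ (msupp μ)) ≤ lam.real {y | a * (c * δ ^ m) ≤ F y} :=
    measureReal_mono (fun y hy => hlow y hy)
  rw [← ENNReal.toReal_le_toReal (measure_ne_top _ _) ENNReal.ofReal_ne_top,
    ENNReal.toReal_ofReal (by positivity)]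
  change lam.real _ ≤ _
  refine hsub.trans ?_
  have hδm : 0 < δ ^ m := Real.rpow_pos_of_pos hδ m
  rw [Real.rpow_sub hδ, Real.rpow_natCast, div_mul_div_comm, le_div_iff₀ (by positivity)]
  have hδn : 0 < δ ^ n := by positivity
  nlinarith
end
end

section
/- Let n ≥ 1 be an integer and let σ, κ > 0 be real numbers with σ + κ > n. Let μ and λ be finite Borel measures on ℝ^n such that there are constants C₁, C₂ > 0 with |μ̂(ξ)| ≤ C₁|ξ|^{−σ} for all ξ ≠ 0 and ∫_{|ξ|≤R} |λ̂(ξ)| dξ ≤ C₂ R^{n−κ} for all R ≥ 1. Then ∫_{ℝ^n} |μ̂(ξ)| · |λ̂(ξ)| dξ < ∞. -/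
open MeasureTheory Metric Filter Set
open scoped ENNReal NNReal Real Topology

noncomputable section

lemma mft_continuous {n : ℕ} (μ : Measure (EuclideanSpace ℝ (Fin n))) [IsFiniteMeasure μ] :
    Continuous (mft μ) := by
  unfold mft
  refine continuous_of_dominated (bound := fun _ => 1) ?_ ?_ (integrable_const _) ?_
  · intro ξ
    exact (by fun_prop : Continuous fun x : EuclideanSpace ℝ (Fin n) =>
      Complex.exp ((((-(2 * Real.pi * (inner ℝ x ξ : ℝ))) : ℝ) : ℂ) *
        Complex.I)).aestronglyMeasurable
  · intro ξ
    filter_upwards with x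
    rw [Complex.norm_exp_ofReal_mul_I]
  · filter_upwards with x
    fun_prop

/-- if `|μ̂(ξ)| ≤ C₁|ξ|^{-σ}` for ξ ≠ 0 and `∫_{|ξ|≤R} |λ̂(ξ)| dξ ≤ C₂ R^{n-κ}`
for all `R ≥ 1`, with `σ + κ > n`, then `∫ |μ̂(ξ)|·|λ̂(ξ)| dξ < ∞`. -/
theorem statement1 (n : ℕ) (hn : 1 ≤ n) (σ κ : ℝ) (hσ : 0 < σ) (hκ : 0 < κ)
    (hσκ : (n : ℝ) < σ + κ)
    (μ lam : Measure (EuclideanSpace ℝ (Fin n)))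
    [IsFiniteMeasure μ] [IsFiniteMeasure lam]
    (C₁ C₂ : ℝ) (hC₁ : 0 < C₁) (hC₂ : 0 < C₂)
    (hdecay : ∀ ξ : EuclideanSpace ℝ (Fin n), ξ ≠ 0 → ‖mft μ ξ‖ ≤ C₁ * ‖ξ‖ ^ (-σ))
    (hlam : ∀ R : ℝ, 1 ≤ R →
      ∫ ξ in Metric.closedBall (0 : EuclideanSpace ℝ (Fin n)) R, ‖mft lam ξ‖ ≤
        C₂ * R ^ ((n : ℝ) - κ)) :
    Integrable (fun ξ : EuclideanSpace ℝ (Fin n) => ‖mft μ ξ‖ * ‖mft lam ξ‖) := by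
  have hμc := mft_continuous μ
  have hlc := mft_continuous lam
  have hfc : Continuous (fun ξ : EuclideanSpace ℝ (Fin n) => ‖mft μ ξ‖ * ‖mft lam ξ‖) := by
    fun_prop
  let A : ℕ → Set (EuclideanSpace ℝ (Fin n)) :=
    fun k => closedBall 0 ((2 : ℝ) ^ (k + 1)) \ ball 0 ((2 : ℝ) ^ k)
  have hAc : ∀ k, IsCompact (A k) := fun k => (isCompact_closedBall _ _).diff isOpen_ball
  have hAm : ∀ k, MeasurableSet (A k) := fun k => (hAc k).measurableSet
  have hcov : closedBall 0 1 ∪ (⋃ k, A k) = univ := by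
    refine eq_univ_of_forall fun ξ => ?_
    by_cases h : ‖ξ‖ ≤ 1
    · left
      simpa using h
    · right
      obtain ⟨k, h1, h2⟩ := exists_nat_pow_near (le_of_not_ge h) (one_lt_two)
      refine mem_iUnion.2 ⟨k, ?_, ?_⟩
      · simpa using h2.le
      · simpa using h1
  rw [← integrableOn_univ, ← hcov]
  refine IntegrableOn.union (hfc.continuousOn.integrableOn_compact (isCompact_closedBall _ _)) ?_
  refine integrableOn_iUnion_of_summable_integral_norm
    (fun k => hfc.continuousOn.integrableOn_compact (hAc k)) ?_
  have hr0 : (0 : ℝ) ≤ 2 ^ ((n : ℝ) - κ - σ) := by positivity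
  have hr1 : (2 : ℝ) ^ ((n : ℝ) - κ - σ) < 1 :=
    Real.rpow_lt_one_of_one_lt_of_neg one_lt_two (by linarith)
  refine Summable.of_nonneg_of_le (fun k => integral_nonneg fun _ => norm_nonneg _) (fun k => ?_)
    ((summable_geometric_of_lt_one hr0 hr1).mul_left (C₁ * C₂ * 2 ^ ((n : ℝ) - κ)))
  have hI : IntegrableOn (fun ξ => ‖mft lam ξ‖) (closedBall 0 ((2 : ℝ) ^ (k + 1))) :=
    hlc.norm.continuousOn.integrableOn_compact (isCompact_closedBall _ _)
  have hsub : A k ⊆ closedBall 0 ((2 : ℝ) ^ (k + 1)) := diff_subset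
  have hpk : (0 : ℝ) < 2 ^ k := by positivity
  calc ∫ ξ in A k, ‖‖mft μ ξ‖ * ‖mft lam ξ‖‖
      ≤ ∫ ξ in A k, (C₁ * ((2 : ℝ) ^ k) ^ (-σ)) * ‖mft lam ξ‖ := by
        refine setIntegral_mono_on (hfc.norm.continuousOn.integrableOn_compact (hAc k))
          ((hI.mono_set hsub).const_mul _) (hAm k) fun ξ hξ => ?_
        have hξ' : (2 : ℝ) ^ k ≤ ‖ξ‖ := by simpa using hξ.2
        have hξ0 : ξ ≠ 0 := norm_pos_iff.1 (hpk.trans_le hξ')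
        rw [Real.norm_of_nonneg (by positivity)]
        refine mul_le_mul_of_nonneg_right ((hdecay ξ hξ0).trans ?_) (norm_nonneg _)
        exact mul_le_mul_of_nonneg_left
          (Real.rpow_le_rpow_of_nonpos hpk hξ' (by linarith)) hC₁.le
    _ = (C₁ * ((2 : ℝ) ^ k) ^ (-σ)) * ∫ ξ in A k, ‖mft lam ξ‖ := integral_const_mul _ _
    _ ≤ (C₁ * ((2 : ℝ) ^ k) ^ (-σ)) * (C₂ * ((2 : ℝ) ^ (k + 1)) ^ ((n : ℝ) - κ)) := by
        refine mul_le_mul_of_nonneg_left ?_ (by positivity)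
        refine le_trans ?_ (hlam _ (one_le_pow₀ one_le_two))
        exact setIntegral_mono_set hI (Eventually.of_forall fun _ => norm_nonneg _)
          hsub.eventuallyLE
    _ = C₁ * C₂ * 2 ^ ((n : ℝ) - κ) * (2 ^ ((n : ℝ) - κ - σ)) ^ k := by
        have e : ((2 : ℝ) ^ ((n : ℝ) - κ - σ)) ^ k
            = ((2 : ℝ) ^ k) ^ ((n : ℝ) - κ) * ((2 : ℝ) ^ k) ^ (-σ) := by
          rw [← Real.rpow_add hpk, ← Real.rpow_natCast, ← Real.rpow_natCast, ← Real.rpow_mul (by norm_num),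
            ← Real.rpow_mul (by norm_num)]
          congr 1
          ring
        rw [e, pow_succ, Real.mul_rpow hpk.le (by norm_num)]
        ring
end
end

section
/- Let n ≥ 1 and p ≥ 2 be integers, let σ, κ > 0 with σ + κ > n, and let 0 < s ≤ n. Let μ and λ be Borel probability measures on the torus 𝕋^n = ℝ^n/ℤ^n such that: |μ̂(ξ)| ≤ C₁|ξ|^{−σ} for all ξ ∈ ℤ^n \ {0}; Σ_{ξ∈ℤ^n, 0<|ξ|≤R} |λ̂(ξ)| ≤ C₂ R^{n−κ} for all R ≥ 1; and λ is AD-regular with exponent s. For each integer l ≥ 0 define the probability measure μ_l on 𝕋^n by μ_l(A) = p^{−nl} Σ_{d∈{0,…,p^l−1}^n} μ(A − d/p^l). Then there exist an integer l₀ ≥ 0 and constants c > 0, δ₀ > 0 such that for every l ≥ l₀ and every δ ∈ (0, δ₀), μ_l((supp λ)^δ) ≥ c δ^{n−s}. -/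
open MeasureTheory Metric Filter Set
open scoped ENNReal NNReal Real Topology

noncomputable section

attribute [local instance] ZeroLEOneClass.factZeroLtOne

/-- The torus 𝕋ⁿ = ℝⁿ/ℤⁿ, with the quotient (Euclidean, i.e. `L²`) metric. -/
abbrev TorusN (n : ℕ) := PiLp 2 (fun _ : Fin n => AddCircle (1 : ℝ))

instance (n : ℕ) : MeasurableSpace (TorusN n) :=
  MeasurableSpace.comap WithLp.ofLp
    (inferInstanceAs (MeasurableSpace (∀ _ : Fin n, AddCircle (1 : ℝ))))

/-- The Fourier coefficient of a measure on the torus at `ξ ∈ ℤⁿ`: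
`μ̂(ξ) = ∫ e^{-2πi⟨x,ξ⟩} dμ(x)`. -/
def ftT {n : ℕ} (μ : Measure (TorusN n)) (ξ : Fin n → ℤ) : ℂ :=
  ∫ x, ∏ i, fourier (T := 1) (-(ξ i)) (x i) ∂μ

/-- A lattice point `ξ ∈ ℤⁿ` viewed as an element of ℝⁿ (for its Euclidean norm). -/
def lat {n : ℕ} (ξ : Fin n → ℤ) : EuclideanSpace ℝ (Fin n) :=
  WithLp.toLp 2 (fun i => (ξ i : ℝ))

/-- AD-regularity with exponent `s`. -/
def ADRegular {X : Type*} [PseudoMetricSpace X] [MeasurableSpace X]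
    (μ : Measure X) (s : ℝ) : Prop :=
  ∃ C : ℝ, 1 < C ∧ ∀ x ∈ msupp μ, ∀ r : ℝ, 0 < r → r ≤ 1 →
    ENNReal.ofReal (C⁻¹ * r ^ s) ≤ μ (Metric.closedBall x r) ∧
      μ (Metric.closedBall x r) ≤ ENNReal.ofReal (C * r ^ s)

/-- The point `d/pˡ ∈ 𝕋ⁿ` for a digit vector `d ∈ {0,…,pˡ-1}ⁿ`. -/
def trvec (n p l : ℕ) (d : Fin n → Fin (p ^ l)) : TorusN n :=
  WithLp.toLp 2 (fun i => (((((d i : ℕ) : ℝ) / (p : ℝ) ^ l : ℝ) : AddCircle (1 : ℝ))))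

/-- The averaged measure `μ_l(A) = p^{-nl} Σ_{d ∈ {0,…,pˡ-1}ⁿ} μ(A - d/pˡ)`. -/
def avgM {n : ℕ} (p : ℕ) (μ : Measure (TorusN n)) (l : ℕ) : Measure (TorusN n) :=
  ((p : ℝ≥0∞) ^ (n * l))⁻¹ •
    ∑ d : Fin n → Fin (p ^ l), Measure.map (fun x => x + trvec n p l d) μ


instance torusN_borel (n : ℕ) : BorelSpace (TorusN n) := PiLp.borelSpace ..

instance circ_prob : IsProbabilityMeasure (volume : Measure (AddCircle (1 : ℝ))) :=
  ⟨by simp [AddCircle.measure_univ]⟩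

instance torus_prob (n : ℕ) : IsProbabilityMeasure (volume : Measure (Fin n → AddCircle (1 : ℝ))) :=
  inferInstance

open UnitAddTorus

lemma integral_mF (n : ℕ) (k : Fin n → ℤ) :
    ∫ x : Fin n → AddCircle (1 : ℝ), mFourier k x = if k = 0 then 1 else 0 := by
  have h1 : ∀ x : Fin n → AddCircle (1 : ℝ), mFourier k x = ∏ i, fourier (k i) (x i) := fun x => rfl
  simp_rw [h1]
  rw [integral_fintype_prod_volume_eq_prod (fun i (x : AddCircle (1 : ℝ)) => (fourier (k i) x : ℂ))]
  split_ifs with hk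
  · subst hk
    simp
  · obtain ⟨i, hi⟩ := Function.ne_iff.mp hk
    apply Finset.prod_eq_zero (Finset.mem_univ i)
    exact integral_eq_zero_of_add_right_eq_neg
      (fun x => fourier_add_half_inv_index hi (by norm_num) x)

lemma mF_norm_le {n : ℕ} (k : Fin n → ℤ) (x : Fin n → AddCircle (1 : ℝ)) : ‖mFourier k x‖ ≤ 1 := by
  exact ((mFourier k).norm_coe_le_norm x).trans_eq mFourier_norm

lemma cont_integrable {n : ℕ} (ν : Measure (Fin n → AddCircle (1 : ℝ))) [IsFiniteMeasure ν]
    {E : Type*} [NormedAddCommGroup E]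
    {f : (Fin n → AddCircle (1 : ℝ)) → E} (hf : Continuous f) : Integrable f ν :=
  hf.integrable_of_hasCompactSupport (HasCompactSupport.of_compactSpace f)

lemma analytic_bound {n : ℕ} (ν : Measure (Fin n → AddCircle (1 : ℝ))) [IsProbabilityMeasure ν]
    (ε : ℝ) (hε : ∀ F : Finset (Fin n → ℤ), 0 ∉ F → ∑ k ∈ F, ‖∫ x, mFourier k x ∂ν‖ ≤ ε)
    (f : C(Fin n → AddCircle (1 : ℝ), ℂ)) :
    ‖∫ x, f x ∂ν - ∫ x, f x‖ ≤ ε * ∫ x, ‖f x‖ := by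
  have hmain : ∀ f ∈ Submodule.span ℂ (range (mFourier (d := Fin n))),
      ‖∫ x, f x ∂ν - ∫ x, f x‖ ≤ ε * ∫ x, ‖f x‖ := by
    intro f hf
    obtain ⟨c, rfl⟩ := Finsupp.mem_span_range_iff_exists_finsupp.mp hf
    set g : C(UnitAddTorus (Fin n), ℂ) := c.sum fun i a => a • mFourier i with hg
    have hgx : ∀ x, g x = ∑ k ∈ c.support, c k * mFourier k x := by
      intro x
      simp [hg, Finsupp.sum, ContinuousMap.sum_apply]
    have hcoef : ∀ k, c k = ∫ x, g x * mFourier (-k) x := by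
      intro k
      have : ∀ x, g x * mFourier (-k) x = ∑ j ∈ c.support, c j * mFourier (j - k) x := by
        intro x
        rw [hgx, Finset.sum_mul]
        refine Finset.sum_congr rfl fun j _ => ?_
        rw [sub_eq_add_neg, mFourier_add]; ring
      simp_rw [this]
      rw [integral_finsetSum _ (fun j _ => (cont_integrable _ (mFourier (j-k)).continuous).const_mul _)]
      simp_rw [integral_const_mul, integral_mF, sub_eq_zero]
      simp
    have hcle : ∀ k, ‖c k‖ ≤ ∫ x, ‖g x‖ := by
      intro k
      rw [hcoef k]
      refine (norm_integral_le_integral_norm _).trans ?_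
      refine integral_mono (cont_integrable _ (by fun_prop)) (cont_integrable _ (by fun_prop)) ?_
      intro x
      simp only [norm_mul]
      exact mul_le_of_le_one_right (norm_nonneg _) (mF_norm_le _ _)
    have hL : ∫ x, g x ∂ν - ∫ x, g x = ∑ k ∈ c.support.erase 0, c k * ∫ x, mFourier k x ∂ν := by
      simp_rw [hgx]
      rw [integral_finsetSum _ (fun j _ => (cont_integrable _ (mFourier j).continuous).const_mul _),
        integral_finsetSum _ (fun j _ => (cont_integrable _ (mFourier j).continuous).const_mul _),
        ← Finset.sum_sub_distrib]
      symm
      apply Finset.sum_subset_zero_on_sdiff (Finset.erase_subset _ _)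
      · intro x hx
        have : x = 0 := by
          simp at hx; tauto
        subst this
        simp [mFourier_zero]
      · intro k hk
        have : k ≠ 0 := by simp at hk; tauto
        rw [integral_const_mul, integral_const_mul, integral_mF]
        simp [this]
    rw [hL]
    calc _ ≤ ∑ k ∈ c.support.erase 0, ‖c k * ∫ x, mFourier k x ∂ν‖ := norm_sum_le _ _
      _ ≤ ∑ k ∈ c.support.erase 0, (∫ x, ‖g x‖) * ‖∫ x, mFourier k x ∂ν‖ := by
        refine Finset.sum_le_sum fun k _ => ?_
        rw [norm_mul]
        gcongr
        exact hcle k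
      _ ≤ _ := by
        rw [← Finset.mul_sum, mul_comm]
        have := hε (c.support.erase 0) (by simp)
        gcongr
  have hcl : ∀ (m : Measure (Fin n → AddCircle (1 : ℝ))) [IsProbabilityMeasure m],
      Continuous (fun f : C(Fin n → AddCircle (1 : ℝ), ℂ) => ∫ x, f x ∂m) := fun m _ =>
    (LipschitzWith.of_dist_le_mul (K := 1) fun f g => by
      rw [dist_eq_norm, ← integral_sub (cont_integrable _ f.continuous)
        (cont_integrable _ g.continuous)]
      refine (norm_integral_le_of_norm_le_const (C := dist f g) (.of_forall fun x => ?_)).trans ?_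
      · rw [← dist_eq_norm]; exact ContinuousMap.dist_apply_le_dist x
      · simp).continuous
  have hcl2 : Continuous (fun f : C(Fin n → AddCircle (1 : ℝ), ℂ) => ∫ x, ‖f x‖) := by
    refine (LipschitzWith.of_dist_le_mul (K := 1) fun f g => ?_).continuous
    rw [dist_eq_norm, ← integral_sub (cont_integrable _ f.continuous.norm)
        (cont_integrable _ g.continuous.norm)]
    refine (norm_integral_le_of_norm_le_const (C := dist f g) (.of_forall fun x => ?_)).trans ?_
    · refine (abs_norm_sub_norm_le _ _).trans ?_
      rw [← dist_eq_norm]; exact ContinuousMap.dist_apply_le_dist x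
    · simp
  have hclosed : IsClosed {f : C(Fin n → AddCircle (1 : ℝ), ℂ) |
      ‖∫ x, f x ∂ν - ∫ x, f x‖ ≤ ε * ∫ x, ‖f x‖} :=
    isClosed_le (((hcl ν).sub (hcl volume)).norm) (continuous_const.mul hcl2)
  have hmem : f ∈ (Submodule.span ℂ (range (mFourier (d := Fin n)))).topologicalClosure := by
    rw [span_mFourier_closure_eq_top]; trivial
  exact closure_minimal hmain hclosed hmem

lemma ball_lower {n : ℕ} (ν : Measure (Fin n → AddCircle (1 : ℝ))) [IsProbabilityMeasure ν]
    (hε : ∀ F : Finset (Fin n → ℤ), 0 ∉ F → ∑ k ∈ F, ‖∫ x, mFourier k x ∂ν‖ ≤ 1 / 2)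
    (η : ℝ) (hη : 0 < η) (hη1 : η ≤ 1) :
    1 / 4 * η ^ n ≤ ν.real (closedBall 0 η) := by
  let f : (Fin n → AddCircle (1 : ℝ)) → ℝ := fun x => max 0 (1 - ‖x‖ / η)
  have hf : Continuous f := by fun_prop
  have hf0 : ∀ x, 0 ≤ f x := fun x => le_max_left _ _
  have key := analytic_bound ν (1 / 2) hε ⟨fun x => (f x : ℂ), by fun_prop⟩
  simp only [ContinuousMap.coe_mk, integral_complex_ofReal, Complex.norm_real, Real.norm_eq_abs,
    ← Complex.ofReal_sub, abs_of_nonneg (hf0 _)] at key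
  have key2 := (abs_le.mp key).1
  have up : ∫ x, f x ∂ν ≤ ν.real (closedBall 0 η) := by
    rw [← integral_indicator_one isClosed_closedBall.measurableSet]
    refine integral_mono (cont_integrable _ hf)
      ((integrable_indicator_iff isClosed_closedBall.measurableSet).mpr
        (integrable_const _).integrableOn) ?_
    intro x
    by_cases hx : x ∈ closedBall (0 : Fin n → AddCircle (1 : ℝ)) η
    · simp only [indicator_of_mem hx, Pi.one_apply]
      refine max_le zero_le_one ?_
      have : 0 ≤ ‖x‖ / η := by positivity
      linarith
    · simp only [indicator_of_notMem hx]
      refine max_le le_rfl ?_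
      have : 1 ≤ ‖x‖ / η := by
        rw [one_le_div hη]
        simp at hx
        exact hx.le
      linarith
  have low : 1 / 2 * (volume : Measure (Fin n → AddCircle (1 : ℝ))).real (closedBall 0 (η / 2))
      ≤ ∫ x, f x := by
    rw [← integral_indicator_one isClosed_closedBall.measurableSet, ← integral_const_mul]
    refine integral_mono (((integrable_indicator_iff isClosed_closedBall.measurableSet).mpr
        (integrable_const _).integrableOn).const_mul _) (cont_integrable _ hf)
       ?_
    intro x
    by_cases hx : x ∈ closedBall (0 : Fin n → AddCircle (1 : ℝ)) (η / 2)
    · simp only [indicator_of_mem hx, Pi.one_apply]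
      refine le_trans ?_ (le_max_right _ _)
      have : ‖x‖ / η ≤ 1 / 2 := by
        rw [div_le_iff₀ hη]
        simp at hx
        linarith
      linarith
    · simp only [indicator_of_notMem hx]
      simpa using hf0 x
  have hv : (volume : Measure (Fin n → AddCircle (1 : ℝ))).real (closedBall 0 (η / 2)) = η ^ n := by
    rw [measureReal_def, volume_pi_closedBall _ (by positivity)]
    simp only [AddCircle.volume_closedBall]
    have : min 1 (2 * (η / 2)) = η := by rw [mul_div_cancel₀ _ two_ne_zero]; exact min_eq_right hη1
    rw [this]
    simp [hη.le]
  rw [hv] at low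
  linarith

lemma dyadic {ι : Type*} (N w a : ι → ℝ) (σ β C : ℝ) (hσ : 0 < σ) (hβ : β < σ) (hC : 0 ≤ C)
    (hw : ∀ i, 0 ≤ w i) (ha : ∀ i, 1 ≤ N i → a i ≤ w i * (N i) ^ (-σ))
    (hW : ∀ R : ℝ, 1 ≤ R → ∀ F : Finset ι, (∀ i ∈ F, 1 ≤ N i ∧ N i ≤ R) →
      ∑ i ∈ F, w i ≤ C * R ^ β) (l : ℕ) (F : Finset ι) (hF : ∀ i ∈ F, 2 ^ l ≤ N i) :
    ∑ i ∈ F, a i ≤ C * 2 ^ β * (1 - 2 ^ (β - σ))⁻¹ * ((2 : ℝ) ^ (β - σ)) ^ l := by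
  classical
  set r : ℝ := 2 ^ (β - σ) with hr
  have hr0 : 0 < r := by positivity
  have hr1 : r < 1 := Real.rpow_lt_one_of_one_lt_of_neg one_lt_two (by linarith)
  have h1 : ∀ i ∈ F, 1 ≤ N i := fun i hi => (one_le_pow₀ one_le_two).trans (hF i hi)
  let j : ι → ℕ := fun i => Nat.log 2 ⌊N i⌋₊
  have hj1 : ∀ i ∈ F, (2 : ℝ) ^ j i ≤ N i := by
    intro i hi
    have h0 : ⌊N i⌋₊ ≠ 0 := (Nat.floor_pos.mpr (h1 i hi)).ne'
    have := Nat.pow_log_le_self 2 h0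
    have h2 := (Nat.le_floor_iff (zero_le_one.trans (h1 i hi))).mp this
    exact_mod_cast h2
  have hj2 : ∀ i ∈ F, N i ≤ (2 : ℝ) ^ (j i + 1) := by
    intro i hi
    have := Nat.lt_pow_succ_log_self one_lt_two ⌊N i⌋₊
    have h2 := (Nat.floor_lt (zero_le_one.trans (h1 i hi))).mp this
    exact_mod_cast h2.le
  have hjl : ∀ i ∈ F, l ≤ j i := by
    intro i hi
    refine Nat.le_log_of_pow_le one_lt_two ?_
    refine Nat.le_floor ?_
    exact_mod_cast hF i hi
  have hfib : ∀ m, ∑ i ∈ F with j i = m, a i ≤ C * 2 ^ β * r ^ m := by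
    intro m
    have hm2 : (2 : ℝ) ^ m = (2 : ℝ) ^ (m : ℝ) := by rw [Real.rpow_natCast]
    calc ∑ i ∈ F with j i = m, a i ≤ ∑ i ∈ F with j i = m, w i * ((2 : ℝ) ^ m) ^ (-σ) := by
          refine Finset.sum_le_sum fun i hi => ?_
          simp only [Finset.mem_filter] at hi
          refine (ha i (h1 i hi.1)).trans ?_
          refine mul_le_mul_of_nonneg_left ?_ (hw i)
          refine Real.rpow_le_rpow_of_nonpos (by positivity) ?_ (by linarith)
          rw [← hi.2]; exact hj1 i hi.1
      _ = (∑ i ∈ F with j i = m, w i) * ((2 : ℝ) ^ m) ^ (-σ) := by rw [Finset.sum_mul]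
      _ ≤ (C * ((2 : ℝ) ^ (m + 1)) ^ β) * ((2 : ℝ) ^ m) ^ (-σ) := by
          refine mul_le_mul_of_nonneg_right ?_ (by positivity)
          refine hW _ (one_le_pow₀ one_le_two) _ fun i hi => ?_
          simp only [Finset.mem_filter] at hi
          refine ⟨h1 i hi.1, ?_⟩
          rw [← hi.2]; exact hj2 i hi.1
      _ = C * 2 ^ β * r ^ m := by
          rw [pow_succ, Real.mul_rpow (by positivity) (by positivity), hr, ← Real.rpow_natCast (2 ^ (β - σ)),
            ← Real.rpow_mul (by positivity), hm2, ← Real.rpow_mul (by positivity),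
            ← Real.rpow_mul (by positivity), sub_mul, sub_eq_add_neg, Real.rpow_add (by positivity)]
          ring_nf
  obtain ⟨M, hM⟩ : ∃ M, ∀ i ∈ F, j i < l + M := by
    refine ⟨F.sup j + 1, fun i hi => ?_⟩
    have := Finset.le_sup (f := j) hi
    omega
  rw [← Finset.sum_fiberwise_of_maps_to (s := F) (t := Finset.Ico l (l + M)) (g := j)
    (fun i hi => Finset.mem_Ico.mpr ⟨hjl i hi, hM i hi⟩)]
  calc _ ≤ ∑ m ∈ Finset.Ico l (l + M), C * 2 ^ β * r ^ m := Finset.sum_le_sum fun m _ => hfib m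
    _ = C * 2 ^ β * (∑ m ∈ Finset.range M, r ^ m) * r ^ l := by
      rw [Finset.sum_Ico_eq_sum_range, Finset.mul_sum, Finset.sum_mul]
      refine Finset.sum_congr (by simp) fun m _ => by rw [pow_add]; ring
    _ ≤ _ := by
      refine mul_le_mul_of_nonneg_right (mul_le_mul_of_nonneg_left ?_ (by positivity)) (by positivity)
      rw [← tsum_geometric_of_lt_one hr0.le hr1]
      exact (summable_geometric_of_lt_one hr0.le hr1).sum_le_tsum _ (fun _ _ => by positivity)

lemma lat_coord {n : ℕ} (k : Fin n → ℤ) (i : Fin n) : |(k i : ℝ)| ≤ ‖lat k‖ := by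
  have := PiLp.norm_apply_le (lat k) i
  simpa [lat] using this

lemma lat_neg {n : ℕ} (k : Fin n → ℤ) : ‖lat (-k)‖ = ‖lat k‖ := by
  have : lat (-k) = - lat k := by
    ext i; simp [lat]
  rw [this, norm_neg]

lemma ftT_eq {n : ℕ} (μ : Measure (TorusN n)) (k : Fin n → ℤ) :
    ftT μ k = ∫ x, mFourier (-k) (WithLp.ofLp x) ∂μ := rfl

lemma cont_mF {n : ℕ} (k : Fin n → ℤ) :
    Continuous (fun x : TorusN n => mFourier k (WithLp.ofLp x)) :=
  (mFourier k).continuous.comp (PiLp.continuous_ofLp 2 _)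

lemma int_mF {n : ℕ} (μ : Measure (TorusN n)) [IsFiniteMeasure μ] (k : Fin n → ℤ) :
    Integrable (fun x : TorusN n => mFourier k (WithLp.ofLp x)) μ :=
  Integrable.of_bound (cont_mF k).aestronglyMeasurable 1 (.of_forall fun x => mF_norm_le k _)

lemma mF_add_arg {n : ℕ} (k : Fin n → ℤ) (x y : Fin n → AddCircle (1 : ℝ)) :
    mFourier k (x + y) = mFourier k x * mFourier k y := by
  simp only [mFourier, ContinuousMap.coe_mk, ← Finset.prod_mul_distrib, Pi.add_apply]
  refine Finset.prod_congr rfl fun i _ => ?_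
  simp [fourier_apply, smul_add, AddCircle.toCircle_add]

lemma mF_neg_arg {n : ℕ} (k : Fin n → ℤ) (x : Fin n → AddCircle (1 : ℝ)) :
    mFourier k (-x) = mFourier (-k) x := by
  simp only [mFourier, ContinuousMap.coe_mk, Pi.neg_apply]
  refine Finset.prod_congr rfl fun i _ => ?_
  simp [fourier_apply]

lemma geom_zero (P : ℕ) (hP : 0 < P) (k : ℤ) (hk : k ≠ 0) (hkP : |(k : ℝ)| < P) :
    ∑ d : Fin P, fourier (T := 1) k ((((d : ℕ) : ℝ) / (P : ℝ) : ℝ) : AddCircle (1 : ℝ)) = 0 := by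
  set z : ℂ := Complex.exp (2 * π * Complex.I * k / P) with hz
  have hPc : (P : ℂ) ≠ 0 := by exact_mod_cast hP.ne'
  have h1 : ∀ d : Fin P, fourier (T := 1) k ((((d : ℕ) : ℝ) / (P : ℝ) : ℝ) : AddCircle (1 : ℝ))
      = z ^ (d : ℕ) := by
    intro d
    rw [fourier_coe_apply, hz, ← Complex.exp_nat_mul]
    congr 1
    push_cast
    field_simp
  simp_rw [h1]
  rw [Fin.sum_univ_eq_sum_range (fun i => z ^ i) P]
  have hzP : z ^ P = 1 := by
    rw [hz, ← Complex.exp_nat_mul, Complex.exp_eq_one_iff]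
    refine ⟨k, ?_⟩
    field_simp
  have hz1 : z ≠ 1 := by
    intro h
    rw [hz, Complex.exp_eq_one_iff] at h
    obtain ⟨m, hm⟩ := h
    have hpi : (2 * π * Complex.I : ℂ) ≠ 0 := Complex.two_pi_I_ne_zero
    have h2 : (k : ℂ) = m * P := by
      field_simp at hm
      have := mul_left_cancel₀ hpi (a := (2 * π * Complex.I : ℂ)) (b := k) (c := m * P)
        (by linear_combination (2 * π * Complex.I) * hm)
      exact this
    have h3 : k = m * P := by exact_mod_cast h2
    have h4 : |k| < P := by exact_mod_cast hkP
    exact hk (Int.eq_zero_of_abs_lt_dvd ⟨m, by rw [h3]; ring⟩ h4)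
  rw [geom_sum_eq hz1, hzP]
  simp

lemma avg_coeff {n : ℕ} (p : ℕ) (μ : Measure (TorusN n)) [IsProbabilityMeasure μ] (l : ℕ)
    (k : Fin n → ℤ) :
    ∫ x, mFourier k (WithLp.ofLp x) ∂(avgM p μ l) =
      ((p : ℝ) ^ (n * l))⁻¹ * ((∫ x, mFourier k (WithLp.ofLp x) ∂μ) *
        ∑ d : Fin n → Fin (p ^ l), mFourier k (WithLp.ofLp (trvec n p l d))) := by
  have hm : ∀ t : TorusN n, Measurable (fun x : TorusN n => x + t) := fun t =>
    (continuous_id.add continuous_const).measurable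
  have hpr : ∀ t : TorusN n, IsProbabilityMeasure (Measure.map (fun x => x + t) μ) := fun t =>
    Measure.isProbabilityMeasure_map (hm t).aemeasurable
  unfold avgM
  rw [integral_smul_measure, integral_finsetSum_measure]
  · have : ∀ d : Fin n → Fin (p ^ l), ∫ x, mFourier k (WithLp.ofLp x)
        ∂(Measure.map (fun x => x + trvec n p l d) μ) =
        (∫ x, mFourier k (WithLp.ofLp x) ∂μ) * mFourier k (WithLp.ofLp (trvec n p l d)) := by
      intro d
      rw [integral_map (hm _).aemeasurable (cont_mF k).aestronglyMeasurable,
        ← integral_mul_const]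
      refine integral_congr_ae (.of_forall fun x => ?_)
      simp only [WithLp.ofLp_add]
      exact mF_add_arg k _ _
    simp_rw [this, ← Finset.mul_sum]
    simp
  · intro d _
    have := hpr (trvec n p l d)
    exact int_mF _ k

instance avg_prob {n : ℕ} (p : ℕ) [NeZero p] (μ : Measure (TorusN n)) [IsProbabilityMeasure μ]
    (l : ℕ) : IsProbabilityMeasure (avgM p μ l) := by
  have hm : ∀ t : TorusN n, Measurable (fun x : TorusN n => x + t) := fun t =>
    (continuous_id.add continuous_const).measurable
  have hpr : ∀ t : TorusN n, IsProbabilityMeasure (Measure.map (fun x => x + t) μ) := fun t =>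
    Measure.isProbabilityMeasure_map (hm t).aemeasurable
  constructor
  simp only [avgM, Measure.smul_apply, Measure.finsetSum_apply, measure_univ, smul_eq_mul]
  simp only [Finset.sum_const, Finset.card_univ, Fintype.card_fun, Fintype.card_fin, nsmul_eq_mul,
    mul_one]
  push_cast
  rw [← pow_mul, mul_comm l n]
  refine ENNReal.inv_mul_cancel ?_ ?_
  · exact pow_ne_zero _ (by exact_mod_cast NeZero.ne p)
  · exact ENNReal.pow_ne_top (ENNReal.natCast_ne_top p)

lemma avg_coeff_le {n : ℕ} (p : ℕ) (hp : 2 ≤ p) (μ : Measure (TorusN n)) [IsProbabilityMeasure μ]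
    (l : ℕ) (k : Fin n → ℤ) :
    ‖∫ x, mFourier k (WithLp.ofLp x) ∂(avgM p μ l)‖ ≤ ‖ftT μ (-k)‖ := by
  rw [avg_coeff, ftT_eq, neg_neg, norm_mul, norm_mul]
  have hS : ‖∑ d : Fin n → Fin (p ^ l), mFourier k (WithLp.ofLp (trvec n p l d))‖
      ≤ (p : ℝ) ^ (n * l) := by
    refine (norm_sum_le _ _).trans ?_
    refine (Finset.sum_le_sum fun d _ => mF_norm_le k _).trans ?_
    simp [← pow_mul, mul_comm l n]
  have hpos : (0 : ℝ) < (p : ℝ) ^ (n * l) := by positivity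
  have h2 : ‖((((p : ℝ) ^ (n * l))⁻¹ : ℝ) : ℂ)‖ = ((p : ℝ) ^ (n * l))⁻¹ := by simp
  rw [h2, inv_mul_le_iff₀ hpos, mul_comm ((p : ℝ) ^ (n * l))]
  gcongr

lemma avg_coeff_zero {n : ℕ} (p : ℕ) (hp : 2 ≤ p) (μ : Measure (TorusN n)) [IsProbabilityMeasure μ]
    (l : ℕ) (k : Fin n → ℤ) (hk : k ≠ 0) (hkl : ‖lat k‖ < (p : ℝ) ^ l) :
    ∫ x, mFourier k (WithLp.ofLp x) ∂(avgM p μ l) = 0 := by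
  rw [avg_coeff]
  have : ∑ d : Fin n → Fin (p ^ l), mFourier k (WithLp.ofLp (trvec n p l d)) = 0 := by
    have h1 : ∀ d : Fin n → Fin (p ^ l), mFourier k (WithLp.ofLp (trvec n p l d)) =
      ∏ i, fourier (T := 1) (k i) ((((d i : ℕ) : ℝ) / ((p ^ l : ℕ) : ℝ) : ℝ) : AddCircle (1 : ℝ)) := by
      intro d
      push_cast
      rfl
    simp_rw [h1]
    rw [← Fintype.piFinset_univ, ← Finset.prod_univ_sum (fun _ => Finset.univ) (fun i (d : Fin (p ^ l)) =>
      fourier (T := 1) (k i) ((((d : ℕ) : ℝ) / ((p ^ l : ℕ) : ℝ) : ℝ) : AddCircle (1 : ℝ)))]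
    obtain ⟨i, hi⟩ := Function.ne_iff.mp hk
    refine Finset.prod_eq_zero (Finset.mem_univ i) ?_
    refine geom_zero _ (by positivity) _ hi ?_
    push_cast
    exact (lat_coord k i).trans_lt hkl
  rw [this]; simp

/-- The law of `x - y` for independent `x`, `y`. -/
def diffLaw {n : ℕ} (α lam : Measure (TorusN n)) : Measure (Fin n → AddCircle (1 : ℝ)) :=
  (α.prod lam).map (fun z => WithLp.ofLp z.1 - WithLp.ofLp z.2)

lemma diff_cont (n : ℕ) : Continuous (fun z : TorusN n × TorusN n =>
    WithLp.ofLp z.1 - WithLp.ofLp z.2) :=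
  ((PiLp.continuous_ofLp 2 _).comp continuous_fst).sub ((PiLp.continuous_ofLp 2 _).comp continuous_snd)

instance diff_prob {n : ℕ} (α lam : Measure (TorusN n)) [IsProbabilityMeasure α]
    [IsProbabilityMeasure lam] : IsProbabilityMeasure (diffLaw α lam) :=
  Measure.isProbabilityMeasure_map (diff_cont n).measurable.aemeasurable

lemma diff_coeff {n : ℕ} (α lam : Measure (TorusN n)) [IsProbabilityMeasure α]
    [IsProbabilityMeasure lam] (k : Fin n → ℤ) :
    ∫ x, mFourier k x ∂(diffLaw α lam) = (∫ x, mFourier k (WithLp.ofLp x) ∂α) * ftT lam k := by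
  unfold diffLaw
  rw [integral_map (diff_cont n).measurable.aemeasurable (mFourier k).continuous.aestronglyMeasurable,
    ftT_eq, ← integral_prod_mul]
  refine integral_congr_ae (.of_forall fun z => ?_)
  simp only [sub_eq_add_neg, mF_add_arg, mF_neg_arg]

lemma lat_finite {n : ℕ} (R : ℝ) : {ξ : Fin n → ℤ | ‖lat ξ‖ ≤ R}.Finite := by
  refine (Set.finite_Icc (fun _ : Fin n => -⌈R⌉) (fun _ => ⌈R⌉)).subset fun ξ hξ => ?_
  have h : ∀ i, |ξ i| ≤ ⌈R⌉ := fun i => by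
    have : |(ξ i : ℝ)| ≤ ⌈R⌉ := (lat_coord ξ i).trans (le_trans hξ (Int.le_ceil R))
    exact_mod_cast this
  exact ⟨fun i => (abs_le.mp (h i)).1, fun i => (abs_le.mp (h i)).2⟩

lemma small_coeffs (n p : ℕ) (hp : 2 ≤ p)
    (σ κ : ℝ) (hσ : 0 < σ) (hσκ : (n : ℝ) < σ + κ)
    (μ lam : Measure (TorusN n)) [IsProbabilityMeasure μ] [IsProbabilityMeasure lam]
    (C₁ C₂ : ℝ) (hC₁ : 0 < C₁) (hC₂ : 0 < C₂)
    (hμ : ∀ ξ : Fin n → ℤ, ξ ≠ 0 → ‖ftT μ ξ‖ ≤ C₁ * ‖lat ξ‖ ^ (-σ))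
    (hlam : ∀ R : ℝ, 1 ≤ R →
      (∑' ξ : Fin n → ℤ, if 0 < ‖lat ξ‖ ∧ ‖lat ξ‖ ≤ R then ‖ftT lam ξ‖ else 0) ≤
        C₂ * R ^ ((n : ℝ) - κ)) :
    ∃ l₀ : ℕ, ∀ l, l₀ ≤ l → ∀ F : Finset (Fin n → ℤ), 0 ∉ F →
      ∑ k ∈ F, ‖∫ x, mFourier k x ∂(diffLaw (avgM p μ l) lam)‖ ≤ 1 / 2 := by
  have : NeZero p := ⟨by omega⟩
  set β : ℝ := n - κ with hβ
  have hβσ : β < σ := by linarith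
  have hr1 : (2 : ℝ) ^ (β - σ) < 1 :=
    Real.rpow_lt_one_of_one_lt_of_neg one_lt_two (by linarith)
  have hr0 : 0 ≤ (2 : ℝ) ^ (β - σ) := by positivity
  have ht : Tendsto (fun l : ℕ => C₁ * C₂ * 2 ^ β * (1 - 2 ^ (β - σ))⁻¹ * ((2 : ℝ) ^ (β - σ)) ^ l)
      atTop (𝓝 0) := by
    simpa using (tendsto_pow_atTop_nhds_zero_of_lt_one hr0 hr1).const_mul
      (C₁ * C₂ * 2 ^ β * (1 - 2 ^ (β - σ))⁻¹)
  obtain ⟨l₀, hl₀⟩ := eventually_atTop.mp (ht.eventually_le_const (show (0 : ℝ) < 1 / 2 by norm_num))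
  refine ⟨l₀, fun l hl F hF => le_trans ?_ (hl₀ l hl)⟩
  have hpl : (2 : ℝ) ^ l ≤ (p : ℝ) ^ l := pow_le_pow_left₀ (by norm_num) (by exact_mod_cast hp) l
  rw [← Finset.sum_filter_of_ne (p := fun k => (2 : ℝ) ^ l ≤ ‖lat k‖)]
  · refine dyadic (fun k => ‖lat k‖) (fun k => C₁ * ‖ftT lam k‖) _ σ β (C₁ * C₂) hσ hβσ
      (by positivity) (fun k => by positivity) ?_ ?_ l _ (fun k hk => (Finset.mem_filter.mp hk).2)
    · intro k hk
      have hk0 : k ≠ 0 := by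
        rintro rfl
        have : lat (0 : Fin n → ℤ) = 0 := by ext i; simp [lat]
        simp only [this, norm_zero] at hk
        linarith
      rw [diff_coeff, norm_mul]
      have h1 := avg_coeff_le p hp μ l k
      have h2 := hμ (-k) (neg_ne_zero.mpr hk0)
      rw [lat_neg] at h2
      calc _ ≤ (C₁ * ‖lat k‖ ^ (-σ)) * ‖ftT lam k‖ := by
            gcongr
            exact h1.trans h2
        _ = _ := by ring
    · intro R hR G hG
      rw [← Finset.mul_sum, mul_assoc]
      refine mul_le_mul_of_nonneg_left ?_ hC₁.le
      refine le_trans ?_ (hlam R hR)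
      have hs : Summable (fun ξ : Fin n → ℤ =>
          if 0 < ‖lat ξ‖ ∧ ‖lat ξ‖ ≤ R then ‖ftT lam ξ‖ else 0) := by
        refine summable_of_hasFiniteSupport ((lat_finite R).subset fun ξ hξ => ?_)
        by_contra h
        simp only [mem_ofPred_eq] at h
        simp [h] at hξ
      refine le_trans (le_of_eq ?_) (hs.sum_le_tsum G fun ξ _ => by split_ifs <;> positivity)
      refine Finset.sum_congr rfl fun ξ hξ => ?_
      rw [if_pos ⟨by linarith [(hG ξ hξ).1], (hG ξ hξ).2⟩]
  · intro k hk hne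
    by_contra hlt
    push Not at hlt
    apply hne
    rw [diff_coeff, avg_coeff_zero p hp μ l k (by rintro rfl; exact hF hk) (hlt.trans_le hpl)]
    simp

lemma dist_le_of_sup {n : ℕ} (x y : TorusN n) (η : ℝ) (hη : 0 ≤ η)
    (h : ‖WithLp.ofLp x - WithLp.ofLp y‖ ≤ η) : dist x y ≤ n * η := by
  rw [PiLp.dist_eq_of_L2]
  refine Real.sqrt_le_iff.mpr ⟨by positivity, ?_⟩
  have h1 : ∀ i, dist (x i) (y i) ^ 2 ≤ η ^ 2 := fun i => by
    refine pow_le_pow_left₀ dist_nonneg ?_ 2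
    rw [dist_eq_norm]
    exact (norm_le_pi_norm (WithLp.ofLp x - WithLp.ofLp y) i).trans h
  refine (Finset.sum_le_sum fun i _ => h1 i).trans ?_
  simp only [Finset.sum_const, Finset.card_univ, Fintype.card_fin, nsmul_eq_mul]
  rw [mul_pow]
  refine mul_le_mul_of_nonneg_right ?_ (by positivity)
  rcases Nat.eq_zero_or_pos n with h | h
  · simp [h]
  · have : (1 : ℝ) ≤ n := by exact_mod_cast h
    nlinarith

lemma msupp_eq {n : ℕ} (lam : Measure (TorusN n)) : msupp lam = lam.support := by
  ext x
  rw [Metric.nhds_basis_ball.mem_measureSupport]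
  rfl

lemma upper {n : ℕ} (α lam : Measure (TorusN n)) [IsProbabilityMeasure α]
    [IsProbabilityMeasure lam] (D : ℝ≥0∞) (δ' : ℝ) (hδ : 0 < δ')
    (hD : ∀ y ∈ msupp lam, lam (closedBall y (2 * δ')) ≤ D) :
    (α.prod lam) {z | dist z.1 z.2 ≤ δ'} ≤ D * α (cthickening δ' (msupp lam)) := by
  have hmeas : MeasurableSet {z : TorusN n × TorusN n | dist z.1 z.2 ≤ δ'} :=
    (isClosed_le (continuous_fst.dist continuous_snd) continuous_const).measurableSet
  rw [Measure.prod_apply hmeas, ← lintegral_indicator_const isClosed_cthickening.measurableSet]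
  refine lintegral_mono fun x => ?_
  have hpre : Prod.mk x ⁻¹' {z : TorusN n × TorusN n | dist z.1 z.2 ≤ δ'} = closedBall x δ' := by
    ext y; simp [dist_comm]
  rw [hpre]
  by_cases h0 : lam (closedBall x δ') = 0
  · rw [h0]; exact zero_le
  · obtain ⟨y, hy, hys⟩ := Measure.nonempty_inter_support_of_pos (pos_iff_ne_zero.mpr h0)
    rw [← msupp_eq] at hys
    have hxy : dist x y ≤ δ' := by rw [dist_comm]; exact hy
    rw [indicator_of_mem (mem_cthickening_of_dist_le x y δ' _ hys hxy)]
    refine (measure_mono ?_).trans (hD y hys)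
    refine closedBall_subset_closedBall' ?_
    linarith
/-- on the torus, if `μ` has polynomially decaying Fourier coefficients,
`λ` has small `l¹`-sums of Fourier coefficients (`σ + κ > n`) and is AD-regular with
exponent `s`, then for all sufficiently large `l` and all sufficiently small `δ > 0`,
`μ_l((supp λ)^δ) ≥ c δ^{n-s}`. -/
theorem statement4 (n p : ℕ) (hn : 1 ≤ n) (hp : 2 ≤ p)
    (σ κ : ℝ) (hσ : 0 < σ) (hκ : 0 < κ) (hσκ : (n : ℝ) < σ + κ)
    (s : ℝ) (hs0 : 0 < s) (hsn : s ≤ n)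
    (μ lam : Measure (TorusN n)) [IsProbabilityMeasure μ] [IsProbabilityMeasure lam]
    (C₁ C₂ : ℝ) (hC₁ : 0 < C₁) (hC₂ : 0 < C₂)
    (hμ : ∀ ξ : Fin n → ℤ, ξ ≠ 0 → ‖ftT μ ξ‖ ≤ C₁ * ‖lat ξ‖ ^ (-σ))
    (hlam : ∀ R : ℝ, 1 ≤ R →
      (∑' ξ : Fin n → ℤ, if 0 < ‖lat ξ‖ ∧ ‖lat ξ‖ ≤ R then ‖ftT lam ξ‖ else 0) ≤
        C₂ * R ^ ((n : ℝ) - κ))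
    (hAD : ADRegular lam s) :
    ∃ l₀ : ℕ, ∃ c δ₀ : ℝ, 0 < c ∧ 0 < δ₀ ∧ ∀ l : ℕ, l₀ ≤ l → ∀ δ : ℝ, 0 < δ → δ < δ₀ →
      ENNReal.ofReal (c * δ ^ ((n : ℝ) - s)) ≤
        avgM p μ l (Metric.cthickening δ (msupp lam)) := by
  have hpz : NeZero p := ⟨by omega⟩
  obtain ⟨C, hC, hADC⟩ := hAD
  obtain ⟨l₀, hl₀⟩ := small_coeffs n p hp σ κ hσ hσκ μ lam C₁ C₂ hC₁ hC₂ hμ hlam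
  have hnpos : (0 : ℝ) < n := by exact_mod_cast hn
  have hn1 : (1 : ℝ) ≤ n := by exact_mod_cast hn
  have hCpos : 0 < C := by linarith
  refine ⟨l₀, 1 / 4 * ((n : ℝ) ^ n)⁻¹ * (C * 2 ^ s)⁻¹, 1 / 2, by positivity, by norm_num, ?_⟩
  intro l hl δ hδ hδ1
  have h1 := ball_lower (diffLaw (avgM p μ l) lam) (hl₀ l hl) (δ / n) (by positivity)
    (by rw [div_le_one hnpos]; linarith)
  have h2 := upper (avgM p μ l) lam (ENNReal.ofReal (C * (2 * δ) ^ s)) δ hδ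
    (fun y hy => (hADC y hy (2 * δ) (by positivity) (by linarith)).2)
  have h3 : diffLaw (avgM p μ l) lam (closedBall 0 (δ / n)) ≤
      ((avgM p μ l).prod lam) {z | dist z.1 z.2 ≤ δ} := by
    unfold diffLaw
    rw [Measure.map_apply (diff_cont n).measurable isClosed_closedBall.measurableSet]
    refine measure_mono fun z hz => ?_
    have hz' : ‖WithLp.ofLp z.1 - WithLp.ofLp z.2‖ ≤ δ / n := by simpa using hz
    have := dist_le_of_sup z.1 z.2 (δ / n) (by positivity) hz'
    rwa [mul_div_cancel₀ _ hnpos.ne'] at this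
  have h4 : ENNReal.ofReal (1 / 4 * (δ / n) ^ n) ≤
      ENNReal.ofReal (C * (2 * δ) ^ s) * avgM p μ l (cthickening δ (msupp lam)) := by
    refine le_trans ?_ (h3.trans h2)
    rw [← ofReal_measureReal]
    exact ENNReal.ofReal_le_ofReal h1
  have hDpos : 0 < C * (2 * δ) ^ s := by positivity
  have h5 : 1 / 4 * (δ / n) ^ n = (C * (2 * δ) ^ s) *
      (1 / 4 * ((n : ℝ) ^ n)⁻¹ * (C * 2 ^ s)⁻¹ * δ ^ ((n : ℝ) - s)) := by
    rw [Real.rpow_sub hδ, Real.rpow_natCast, Real.mul_rpow (by norm_num) hδ.le, div_pow]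
    have : δ ^ s ≠ 0 := by positivity
    have : (2 : ℝ) ^ s ≠ 0 := by positivity
    field_simp
  rw [h5, ENNReal.ofReal_mul hDpos.le] at h4
  exact (ENNReal.mul_le_mul_iff_right (by simpa using hDpos) ENNReal.ofReal_ne_top).mp h4
end
end

section
/- Let n ≥ 1 be an integer, let 0 < m < n, σ > 0 and κ > n − σ be real numbers. Let μ be a compactly supported Borel probability measure on ℝ^n for which there are constants C₁, c > 0 with |μ̂(ξ)| ≤ C₁|ξ|^{−σ} for all ξ ≠ 0 and μ(B(x,r)) ≥ c r^m for every x ∈ supp μ and every 0 < r ≤ 1. Let λ be a compactly supported Borel probability measure on ℝ^n with ∫_{|ξ|≤R} |λ̂(ξ)| dξ ≤ C₂ R^{n−κ} for all R ≥ 1 and some C₂ > 0. For t > 0, v ∈ ℝ^n and g ∈ O(n) let T_{t,v,g}(x) = t·g(x) + v. Then for every (t, v, g) ∈ (0,∞) × ℝ^n × O(n), the quantity limsup_{δ→0} λ((T_{t,v,g}(supp μ))^δ) / δ^{n−m} is finite. -/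
open MeasureTheory Metric Filter Set
open scoped ENNReal NNReal Real Topology

noncomputable section

abbrev ESp (n : ℕ) := EuclideanSpace ℝ (Fin n)

lemma mft_eq_charFun {n : ℕ} (μ : Measure (ESp n)) (ξ : ESp n) :
    mft μ ξ = charFun μ ((-(2 * Real.pi)) • ξ) := by
  rw [charFun_apply, mft]
  simp only [inner_smul_right, neg_mul]

lemma mft_measurable {n : ℕ} (μ : Measure (ESp n)) [IsProbabilityMeasure μ] :
    Measurable (mft μ) := by
  have h : mft μ = fun ξ => charFun μ ((-(2 * Real.pi)) • ξ) := funext (mft_eq_charFun μ)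
  rw [h]
  exact measurable_charFun.comp (measurable_const_smul _)

lemma mft_norm_le {n : ℕ} (μ : Measure (ESp n)) [IsProbabilityMeasure μ] (ξ : ESp n) :
    ‖mft μ ξ‖ ≤ 1 := by
  rw [mft_eq_charFun]; exact norm_charFun_le_one _

lemma gauss_ft {n : ℕ} (δ : ℝ) (hδ : 0 < δ) (w : ESp n) :
    ∫ ξ : ESp n, Complex.exp (-((Real.pi * δ ^ 2 : ℝ) : ℂ) * ‖ξ‖ ^ 2
      + (-(2 * Real.pi * Complex.I)) * (inner ℝ w ξ : ℝ)) =
      ((δ ^ (-(n : ℝ)) * Real.exp (-Real.pi * ‖w‖ ^ 2 / δ ^ 2) : ℝ) : ℂ) := by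
  have hb : 0 < ((Real.pi * δ ^ 2 : ℝ) : ℂ).re := by
    rw [Complex.ofReal_re]; positivity
  rw [GaussianFourier.integral_cexp_neg_mul_sq_norm_add hb]
  have hpi : (Real.pi : ℂ) ≠ 0 := by exact_mod_cast Real.pi_ne_zero
  have hd : (δ : ℂ) ≠ 0 := by exact_mod_cast hδ.ne'
  rw [Complex.ofReal_mul (δ ^ (-(n : ℝ)))]
  congr 1
  · have e1 : (Real.pi : ℂ) / ((Real.pi * δ ^ 2 : ℝ) : ℂ) = ((δ ^ (-2 : ℝ) : ℝ) : ℂ) := by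
      rw [Real.rpow_neg hδ.le]
      push_cast
      norm_num
      field_simp
    have e2 : ((Module.finrank ℝ (ESp n) : ℂ) / 2) = (((n : ℝ) / 2 : ℝ) : ℂ) := by
      simp
    rw [e1, e2, ← Complex.ofReal_cpow (by positivity), ← Real.rpow_mul hδ.le]
    congr 2
    ring
  · rw [Complex.ofReal_exp]
    congr 1
    push_cast
    have : (-(2 * (Real.pi : ℂ) * Complex.I)) ^ 2 = - (4 * Real.pi ^ 2) := by
      rw [neg_sq, mul_pow, Complex.I_sq]; ring
    rw [this]
    field_simp

lemma mft_shift {n : ℕ} (μ : Measure (ESp n)) (t : ℝ) (v : ESp n)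
    (g : ESp n ≃ₗᵢ[ℝ] ESp n) (ξ : ESp n) :
    ‖∫ z, Complex.exp (2 * Real.pi * Complex.I * (inner ℝ (t • g z + v) ξ : ℝ)) ∂μ‖
      = ‖mft μ (-(t • g.symm ξ))‖ := by
  have h : ∀ z, Complex.exp (2 * Real.pi * Complex.I * (inner ℝ (t • g z + v) ξ : ℝ))
      = Complex.exp (((2 * Real.pi * (inner ℝ v ξ : ℝ) : ℝ) : ℂ) * Complex.I) *
        Complex.exp ((((-(2 * Real.pi * (inner ℝ z (-(t • g.symm ξ)) : ℝ))) : ℝ) : ℂ)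
          * Complex.I) := by
    intro z
    have h1 : inner ℝ (g z) ξ = inner ℝ z (g.symm ξ) := by
      rw [← g.inner_map_map z (g.symm ξ), g.apply_symm_apply]
    rw [← Complex.exp_add, inner_add_left, inner_neg_right, inner_smul_left, inner_smul_right, h1]
    congr 1
    push_cast
    simp
    ring
  simp_rw [h]
  rw [integral_const_mul, norm_mul, Complex.norm_exp_ofReal_mul_I, one_mul]
  rfl

lemma energy_bound {n : ℕ} (μ lam : Measure (ESp n))
    [IsProbabilityMeasure μ] [IsProbabilityMeasure lam] (t : ℝ) (v : ESp n)
    (g : ESp n ≃ₗᵢ[ℝ] ESp n)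
    (hint : Integrable (fun ξ : ESp n => ‖mft lam ξ‖ * ‖mft μ (-(t • g.symm ξ))‖))
    (δ : ℝ) (hδ : 0 < δ) :
    ∫ p, δ ^ (-(n : ℝ)) * Real.exp (-Real.pi * ‖p.1 - (t • g p.2 + v)‖ ^ 2 / δ ^ 2)
      ∂(lam.prod μ) ≤ ∫ ξ : ESp n, ‖mft lam ξ‖ * ‖mft μ (-(t • g.symm ξ))‖ := by
  set F : (ESp n × ESp n) → ESp n → ℂ := fun p ξ =>
    Complex.exp (-((Real.pi * δ ^ 2 : ℝ) : ℂ) * ‖ξ‖ ^ 2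
      + (-(2 * Real.pi * Complex.I)) * (inner ℝ (p.1 - (t • g p.2 + v)) ξ : ℝ)) with hF
  have hFn : ∀ p ξ, ‖F p ξ‖ = Real.exp (-(Real.pi * δ ^ 2) * ‖ξ‖ ^ 2) := by
    intro p ξ
    rw [hF, Complex.norm_exp]
    congr 1
    norm_cast
    simp
    norm_cast
    simp
  have hG : Integrable (fun ξ : ESp n => Real.exp (-(Real.pi * δ ^ 2) * ‖ξ‖ ^ 2)) := by
    have hb : 0 < ((Real.pi * δ ^ 2 : ℝ) : ℂ).re := by
      rw [Complex.ofReal_re]; positivity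
    have := (GaussianFourier.integrable_cexp_neg_mul_sq_norm_add hb 0 (0 : ESp n)).norm
    refine this.congr (ae_of_all _ fun ξ => ?_)
    simp only [Complex.norm_exp]
    congr 1
    norm_cast
    simp
  have hgc : Continuous fun z => g z := g.continuous
  have hFi : Integrable (Function.uncurry F) ((lam.prod μ).prod volume) := by
    have h2 : Integrable (fun q : (ESp n × ESp n) × ESp n =>
        (1 : ℝ) * Real.exp (-(Real.pi * δ ^ 2) * ‖q.2‖ ^ 2)) ((lam.prod μ).prod volume) :=
      Integrable.mul_prod (f := fun _ => (1 : ℝ)) (integrable_const _) hG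
    refine h2.mono' ?_ (ae_of_all _ fun q => ?_)
    · apply Continuous.aestronglyMeasurable
      simp only [Function.uncurry_def, hF]
      fun_prop
    · rw [Function.uncurry_def]; simp only [hFn, one_mul]; exact le_rfl
  have hsw := integral_integral_swap hFi
  have hL : ∀ p, ∫ ξ, F p ξ = ((δ ^ (-(n : ℝ)) *
      Real.exp (-Real.pi * ‖p.1 - (t • g p.2 + v)‖ ^ 2 / δ ^ 2) : ℝ) : ℂ) :=
    fun p => gauss_ft δ hδ _
  simp_rw [hL] at hsw
  rw [integral_complex_ofReal] at hsw
  have hR : ∀ ξ, ‖∫ p, F p ξ ∂(lam.prod μ)‖ ≤ ‖mft lam ξ‖ * ‖mft μ (-(t • g.symm ξ))‖ := by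
    intro ξ
    have h1 : ∀ p : ESp n × ESp n, F p ξ = Complex.exp (-((Real.pi * δ ^ 2 : ℝ) : ℂ) * ‖ξ‖ ^ 2) *
        (Complex.exp ((((-(2 * Real.pi * (inner ℝ p.1 ξ : ℝ))) : ℝ) : ℂ) * Complex.I) *
        Complex.exp (2 * Real.pi * Complex.I * (inner ℝ (t • g p.2 + v) ξ : ℝ))) := by
      intro p
      simp only [hF]
      rw [← Complex.exp_add, ← Complex.exp_add, inner_sub_left]
      congr 1
      push_cast
      ring
    simp_rw [h1]
    rw [integral_const_mul, integral_prod_mul (μ := lam) (ν := μ)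
      (fun x : ESp n => Complex.exp ((((-(2 * Real.pi * (inner ℝ x ξ : ℝ))) : ℝ) : ℂ) * Complex.I))
      (fun z : ESp n => Complex.exp (2 * Real.pi * Complex.I * (inner ℝ (t • g z + v) ξ : ℝ))),
      norm_mul, norm_mul, mft_shift]
    have h3 : ‖Complex.exp (-((Real.pi * δ ^ 2 : ℝ) : ℂ) * ‖ξ‖ ^ 2)‖ ≤ 1 := by
      have : -((Real.pi * δ ^ 2 : ℝ) : ℂ) * (‖ξ‖ : ℂ) ^ 2
        = ((-(Real.pi * δ ^ 2 * ‖ξ‖ ^ 2) : ℝ) : ℂ) := by push_cast; ring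
      rw [this, Complex.norm_exp, Complex.ofReal_re, Real.exp_le_one_iff]
      have : 0 ≤ Real.pi * δ ^ 2 * ‖ξ‖ ^ 2 := by positivity
      linarith
    exact mul_le_of_le_one_left (by positivity) h3
  calc _ ≤ ‖((∫ p, δ ^ (-(n : ℝ)) * Real.exp (-Real.pi * ‖p.1 - (t • g p.2 + v)‖ ^ 2 / δ ^ 2)
      ∂(lam.prod μ) : ℝ) : ℂ)‖ := by rw [Complex.norm_real]; exact Real.le_norm_self _
    _ = ‖∫ ξ, ∫ p, F p ξ ∂(lam.prod μ)‖ := by rw [← hsw]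
    _ ≤ _ := norm_integral_le_of_norm_le hint (ae_of_all _ hR)

lemma prod_integrable {n : ℕ} (σ κ : ℝ) (hκ : (n : ℝ) - σ < κ) (lam : Measure (ESp n))
    [IsProbabilityMeasure lam] (C C₂ : ℝ) (hC : 0 < C) (hσ : 0 < σ)
    (hlam : ∀ R : ℝ, 1 ≤ R →
      ∫ ξ in Metric.closedBall (0 : ESp n) R, ‖mft lam ξ‖ ≤ C₂ * R ^ ((n : ℝ) - κ))
    (f : ESp n → ℝ) (hf : Measurable f) (hf0 : ∀ ξ, 0 ≤ f ξ) (hf1 : ∀ ξ, f ξ ≤ 1)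
    (hfd : ∀ ξ, ξ ≠ 0 → f ξ ≤ C * ‖ξ‖ ^ (-σ)) :
    Integrable (fun ξ : ESp n => ‖mft lam ξ‖ * f ξ) := by
  have hm : Measurable (fun ξ : ESp n => ‖mft lam ξ‖ * f ξ) := (mft_measurable lam).norm.mul hf
  have hball : ∀ R : ℝ, IntegrableOn (fun ξ : ESp n => ‖mft lam ξ‖) (closedBall 0 R) := by
    intro R
    refine Measure.integrableOn_of_bounded (M := 1) (measure_closedBall_lt_top).ne
      (mft_measurable lam).norm.aestronglyMeasurable (ae_of_all _ fun ξ => ?_)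
    rw [norm_norm]; exact mft_norm_le lam ξ
  have hlball : ∀ R : ℝ, 1 ≤ R → ∫⁻ ξ in closedBall (0 : ESp n) R, ENNReal.ofReal ‖mft lam ξ‖
      ≤ ENNReal.ofReal (C₂ * R ^ ((n : ℝ) - κ)) := by
    intro R hR
    rw [← ofReal_integral_eq_lintegral_ofReal (hball R) (ae_of_all _ fun ξ => norm_nonneg _)]
    exact ENNReal.ofReal_le_ofReal (hlam R hR)
  have hA : ∀ j : ℕ, ∫⁻ ξ in closedBall (0 : ESp n) (2 ^ (j + 1)) \ closedBall 0 (2 ^ j),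
      ENNReal.ofReal (‖mft lam ξ‖ * f ξ) ≤
      ENNReal.ofReal (C * C₂ * 2 ^ ((n : ℝ) - κ) * ((2 : ℝ) ^ ((n : ℝ) - κ - σ)) ^ j) := by
    intro j
    calc _ ≤ ∫⁻ ξ in closedBall (0 : ESp n) (2 ^ (j + 1)) \ closedBall 0 (2 ^ j),
          ENNReal.ofReal (C * ((2 : ℝ) ^ j) ^ (-σ)) * ENNReal.ofReal ‖mft lam ξ‖ := by
          refine setLIntegral_mono' (measurableSet_closedBall.diff measurableSet_closedBall) ?_
          intro ξ hξ
          have h1 : (2 : ℝ) ^ j < ‖ξ‖ := by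
            have := hξ.2
            simpa using this
          have h0 : (0 : ℝ) < 2 ^ j := by positivity
          have hne : ξ ≠ 0 := by
            rw [← norm_pos_iff]; linarith
          rw [← ENNReal.ofReal_mul (by positivity), mul_comm]
          refine ENNReal.ofReal_le_ofReal (mul_le_mul_of_nonneg_right ?_ (norm_nonneg _))
          refine (hfd ξ hne).trans (mul_le_mul_of_nonneg_left ?_ hC.le)
          exact Real.rpow_le_rpow_of_nonpos h0 h1.le (by linarith)
      _ ≤ ∫⁻ ξ in closedBall (0 : ESp n) (2 ^ (j + 1)),
          ENNReal.ofReal (C * ((2 : ℝ) ^ j) ^ (-σ)) * ENNReal.ofReal ‖mft lam ξ‖ :=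
          lintegral_mono_set sdiff_subset
      _ ≤ ENNReal.ofReal (C * ((2 : ℝ) ^ j) ^ (-σ)) *
          ENNReal.ofReal (C₂ * (2 ^ (j + 1)) ^ ((n : ℝ) - κ)) := by
          rw [lintegral_const_mul _ (mft_measurable lam).norm.ennreal_ofReal]
          gcongr
          exact hlball _ (one_le_pow₀ (by norm_num))
      _ = _ := by
          rw [← ENNReal.ofReal_mul (by positivity)]
          congr 1
          have e1 : ((2 : ℝ) ^ j) ^ (-σ) = (2 ^ (-σ)) ^ j := by
            rw [← Real.rpow_natCast, ← Real.rpow_natCast, ← Real.rpow_mul (by norm_num),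
              ← Real.rpow_mul (by norm_num), mul_comm]
          have e2 : ((2 : ℝ) ^ j) ^ ((n : ℝ) - κ) = (2 ^ ((n : ℝ) - κ)) ^ j := by
            rw [← Real.rpow_natCast, ← Real.rpow_natCast, ← Real.rpow_mul (by norm_num),
              ← Real.rpow_mul (by norm_num), mul_comm]
          rw [pow_succ, Real.mul_rpow (by positivity) (by norm_num), e1, e2,
            sub_eq_add_neg ((n : ℝ) - κ) σ, Real.rpow_add (by norm_num), mul_pow]
          ring
  have hcover : (univ : Set (ESp n)) ⊆ closedBall 0 1 ∪
      ⋃ j : ℕ, (closedBall (0 : ESp n) (2 ^ (j + 1)) \ closedBall 0 (2 ^ j)) := by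
    intro ξ _
    by_cases h : ‖ξ‖ ≤ 1
    · left; simpa using h
    · right
      have hex : ∃ k : ℕ, ‖ξ‖ ≤ 2 ^ k := by
        obtain ⟨k, hk⟩ := pow_unbounded_of_one_lt ‖ξ‖ (one_lt_two)
        exact ⟨k, hk.le⟩
      classical
      have hs := Nat.find_spec hex
      have hmin := fun k => Nat.find_min hex (m := k)
      generalize Nat.find hex = k at hs hmin
      cases k with
      | zero => simp at hs; exact absurd hs h
      | succ j =>
        refine mem_iUnion.2 ⟨j, ?_, ?_⟩
        · simpa using hs
        · simpa using hmin j (Nat.lt_succ_self j)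
  refine ⟨hm.aestronglyMeasurable, ?_⟩
  rw [hasFiniteIntegral_iff_ofReal (ae_of_all _ fun ξ => mul_nonneg (norm_nonneg _) (hf0 ξ))]
  rw [← setLIntegral_univ]
  refine (lintegral_mono_set hcover).trans_lt ((lintegral_union_le _ _ _).trans_lt ?_)
  refine ENNReal.add_lt_top.2 ⟨?_, ?_⟩
  · refine lt_of_le_of_lt (lintegral_mono (fun ξ => ?_))
      (lt_of_le_of_lt (hlball 1 le_rfl) ENNReal.ofReal_lt_top)
    exact ENNReal.ofReal_le_ofReal (mul_le_of_le_one_right (norm_nonneg _) (hf1 ξ))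
  · refine (lintegral_iUnion_le _ _).trans_lt ((ENNReal.tsum_le_tsum hA).trans_lt ?_)
    refine Summable.tsum_ofReal_lt_top ?_
    refine (summable_geometric_of_lt_one (by positivity) ?_).mul_left _
    exact Real.rpow_lt_one_of_one_lt_of_neg (by norm_num) (by linarith)

/-- with `μ, λ` as in Theorem `Main` (polynomial Fourier decay and lower
`m`-regularity for `μ`; an `l¹`-type Fourier bound for `λ`; `κ > n - σ`), for every
scaling `t > 0`, translation `v` and orthogonal map `g`, the quantity
`limsup_{δ→0⁺} λ((T_{t,v,g}(supp μ))^δ)/δ^{n-m}` is finite. -/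
theorem statement5 (n : ℕ) (hn : 1 ≤ n) (m : ℝ) (hm0 : 0 < m) (hmn : m < n)
    (σ : ℝ) (hσ : 0 < σ) (κ : ℝ) (hκ : (n : ℝ) - σ < κ)
    (μ lam : Measure (EuclideanSpace ℝ (Fin n)))
    [IsProbabilityMeasure μ] [IsProbabilityMeasure lam]
    (hμcpt : ∃ K : Set (EuclideanSpace ℝ (Fin n)), IsCompact K ∧ μ Kᶜ = 0)
    (hlamcpt : ∃ K : Set (EuclideanSpace ℝ (Fin n)), IsCompact K ∧ lam Kᶜ = 0)
    (C₁ c : ℝ) (hC₁ : 0 < C₁) (hc : 0 < c)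
    (hdecay : ∀ ξ : EuclideanSpace ℝ (Fin n), ξ ≠ 0 → ‖mft μ ξ‖ ≤ C₁ * ‖ξ‖ ^ (-σ))
    (hreg : ∀ x ∈ msupp μ, ∀ r : ℝ, 0 < r → r ≤ 1 →
      ENNReal.ofReal (c * r ^ m) ≤ μ (Metric.closedBall x r))
    (C₂ : ℝ) (hC₂ : 0 < C₂)
    (hlam : ∀ R : ℝ, 1 ≤ R →
      ∫ ξ in Metric.closedBall (0 : EuclideanSpace ℝ (Fin n)) R, ‖mft lam ξ‖ ≤
        C₂ * R ^ ((n : ℝ) - κ))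
    (t : ℝ) (ht : 0 < t) (v : EuclideanSpace ℝ (Fin n))
    (g : EuclideanSpace ℝ (Fin n) ≃ₗᵢ[ℝ] EuclideanSpace ℝ (Fin n)) :
    Filter.limsup (fun δ : ℝ =>
        lam (Metric.cthickening δ ((fun x => t • g x + v) '' msupp μ)) /
          ENNReal.ofReal (δ ^ ((n : ℝ) - m)))
      (nhdsWithin 0 (Set.Ioi (0 : ℝ))) < ⊤ := by
  set f : ESp n → ℝ := fun ξ => ‖mft μ (-(t • g.symm ξ))‖ with hf
  have hfd : ∀ ξ, ξ ≠ 0 → f ξ ≤ (C₁ * t ^ (-σ)) * ‖ξ‖ ^ (-σ) := by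
    intro ξ hξ
    have hne : -(t • g.symm ξ) ≠ 0 := by
      simpa [ht.ne'] using hξ
    refine (hdecay _ hne).trans_eq ?_
    rw [norm_neg, norm_smul, Real.norm_of_nonneg ht.le, g.symm.norm_map,
      Real.mul_rpow ht.le (norm_nonneg _), mul_assoc]
  have hgs : Continuous fun ξ => g.symm ξ := g.symm.continuous
  have hgc : Continuous fun z => g z := g.continuous
  have hint : Integrable (fun ξ : ESp n => ‖mft lam ξ‖ * f ξ) := by
    refine prod_integrable σ κ hκ lam (C₁ * t ^ (-σ)) C₂ (by positivity) hσ hlam f ?_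
      (fun ξ => norm_nonneg _) (fun ξ => mft_norm_le μ _) hfd
    have : Measurable (fun ξ : ESp n => -(t • g.symm ξ)) :=
      Continuous.measurable (by fun_prop)
    exact ((mft_measurable μ).comp this).norm
  set M : ℝ := ∫ ξ : ESp n, ‖mft lam ξ‖ * f ξ with hM
  have key : ∀ δ : ℝ, 0 < δ → δ ≤ 1 →
      lam (Metric.cthickening δ ((fun x => t • g x + v) '' msupp μ)) /
        ENNReal.ofReal (δ ^ ((n : ℝ) - m)) ≤
        ENNReal.ofReal (M / (c * Real.exp (-Real.pi * (2 + t) ^ 2))) := by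
    intro δ hδ hδ1
    set E := Metric.cthickening δ ((fun x => t • g x + v) '' msupp μ) with hE
    have hen := energy_bound μ lam t v g hint δ hδ
    set k : ESp n × ESp n → ℝ := fun p =>
      δ ^ (-(n : ℝ)) * Real.exp (-Real.pi * ‖p.1 - (t • g p.2 + v)‖ ^ 2 / δ ^ 2) with hk
    set e : ℝ := δ ^ (-(n : ℝ)) * Real.exp (-Real.pi * (2 + t) ^ 2) with he
    have hkc : Continuous k := by rw [hk]; fun_prop
    have hki : Integrable k (lam.prod μ) := by
      refine Integrable.of_bound hkc.aestronglyMeasurable (δ ^ (-(n : ℝ))) (ae_of_all _ fun p => ?_)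
      rw [Real.norm_of_nonneg (by positivity)]
      refine mul_le_of_le_one_right (by positivity) ?_
      rw [Real.exp_le_one_iff, neg_mul, neg_div]
      have : 0 ≤ Real.pi * ‖p.1 - (t • g p.2 + v)‖ ^ 2 / δ ^ 2 := by positivity
      linarith
    have hmarkov := mul_meas_ge_le_integral_of_nonneg (μ := lam.prod μ) (f := k)
      (ae_of_all _ fun p => by positivity) hki e
    set S : Set (ESp n × ESp n) := {p | e ≤ k p} with hS
    have hSm : MeasurableSet S := measurableSet_le measurable_const hkc.measurable
    have hlow : ENNReal.ofReal (c * δ ^ m) * lam E ≤ lam.prod μ S := by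
      rw [Measure.prod_apply hSm, ← setLIntegral_const]
      refine le_trans ?_ (setLIntegral_le_lintegral E _)
      refine setLIntegral_mono' isClosed_cthickening.measurableSet ?_
      intro x hx
      have hx2 := cthickening_subset_thickening' (δ₂ := 2 * δ) (by positivity) (by linarith) _ hx
      obtain ⟨y, ⟨z, hz, rfl⟩, hxy⟩ := mem_thickening_iff.1 hx2
      refine (hreg z hz δ hδ hδ1).trans (measure_mono fun w hw => ?_)
      show e ≤ k (x, w)
      have hd : ‖x - (t • g w + v)‖ ≤ (2 + t) * δ := by
        have h1 : dist (t • g w + v) (t • g z + v) ≤ t * δ := by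
          rw [dist_add_right, dist_smul₀, g.dist_map, Real.norm_of_nonneg ht.le]
          exact mul_le_mul_of_nonneg_left (mem_closedBall.1 hw) ht.le
        rw [← dist_eq_norm]
        have h2 := dist_triangle_right x (t • g w + v) (t • g z + v)
        simp only at hxy
        linarith
      simp only [he, hk]
      refine mul_le_mul_of_nonneg_left (Real.exp_le_exp.2 ?_) (by positivity)
      rw [le_div_iff₀ (by positivity)]
      have h3 : ‖x - (t • g w + v)‖ ^ 2 ≤ ((2 + t) * δ) ^ 2 :=
        pow_le_pow_left₀ (norm_nonneg _) hd 2
      have := mul_le_mul_of_nonneg_left h3 Real.pi_pos.le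
      rw [mul_pow] at this
      linarith
    have hlowR : c * δ ^ m * lam.real E ≤ (lam.prod μ).real S := by
      have := ENNReal.toReal_mono (measure_ne_top _ _) hlow
      rwa [ENNReal.toReal_mul, ENNReal.toReal_ofReal (by positivity)] at this
    have hfin : lam.real E ≤
        M / (c * Real.exp (-Real.pi * (2 + t) ^ 2)) * δ ^ ((n : ℝ) - m) := by
      have h4 : e * (c * δ ^ m * lam.real E) ≤ M :=
        (mul_le_mul_of_nonneg_left hlowR (by positivity)).trans (hmarkov.trans hen)
      have h5 : e * (c * δ ^ m * lam.real E) = lam.real E *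
          (c * Real.exp (-Real.pi * (2 + t) ^ 2)) / δ ^ ((n : ℝ) - m) := by
        rw [he, Real.rpow_neg hδ.le, Real.rpow_sub hδ]
        field_simp
      rw [h5, div_le_iff₀ (by positivity)] at h4
      rw [div_mul_eq_mul_div, le_div_iff₀ (by positivity)]
      exact h4
    refine ENNReal.div_le_of_le_mul ?_
    rw [← ENNReal.ofReal_mul' (by positivity), ← ofReal_measureReal]
    exact ENNReal.ofReal_le_ofReal hfin
  refine lt_of_le_of_lt (Filter.limsup_le_of_le (h := ?_)) (ENNReal.ofReal_lt_top (r := M / (c * Real.exp (-Real.pi * (2 + t) ^ 2))))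
  filter_upwards [Ioc_mem_nhdsGT (show (0 : ℝ) < 1 by norm_num)] with δ hδ
  exact key δ hδ.1 hδ.2
end
end
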